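/- arXiv:math/0610988 — 3 statements merged into one kernel-verified Lean document; each statement's English description precedes it below -/
import Mathlib

section
/- Let E be an equivalence relation on the Baire space ℕ^ℕ such that the complement of (the graph of) E is an analytic subset of ℕ^ℕ × ℕ^ℕ (i.e., E is coanalytic; in particular every Borel equivalence relation qualifies). Then either E has at most countably many equivalence classes (there is a countable set C ⊆ ℕ^ℕ meeting every E-class), or there exists a nonempty perfect set P ⊆ ℕ^ℕ whose elements are pairwise E-inequivalent. -/
open MeasureTheory

open Set Filter Topology PiNat

/-- A labelling of the vertices (`h 0`) and of the edges created at stage `k` (`h (k + 1)`) of the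
level-`n` approximation of the graph `𝔾₀`; an edge is indexed by its endpoint carrying `true`. -/
abbrev Labelling := ℕ → List Bool → ℕ → ℕ

namespace Labelling

variable {E : (ℕ → ℕ) → (ℕ → ℕ) → Prop} {φ : (ℕ → ℕ) → (ℕ → ℕ) × (ℕ → ℕ)} {s : ℕ → List Bool}

/-- The edge labels at level `n` are `φ`-codes for the pairs of labels of their endpoints. -/
def Realizes (φ : (ℕ → ℕ) → (ℕ → ℕ) × (ℕ → ℕ)) (s : ℕ → List Bool) (n : ℕ) (h : Labelling) :
    Prop :=
  ∀ k t, k + 1 + t.length = n →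
    φ (h (k + 1) (t ++ true :: s k)) = (h 0 (t ++ false :: s k), h 0 (t ++ true :: s k))

/-- The first `n` values of all labels at level `n`. -/
def truncate (n : ℕ) (h : Labelling) : Fin (n + 1) → {l : List Bool // l.length = n} → Fin n → ℕ :=
  fun k l i => h k l i

/-- A labelling is persistent at level `n` if its truncation is realized by labellings avoiding
any prescribed countable family of equivalence classes. -/
def Persistent (E : (ℕ → ℕ) → (ℕ → ℕ) → Prop) (φ : (ℕ → ℕ) → (ℕ → ℕ) × (ℕ → ℕ))
    (s : ℕ → List Bool) (n : ℕ) (h : Labelling) : Prop :=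
  ∀ C : Set (ℕ → ℕ), C.Countable → ∃ h' : Labelling, Realizes φ s n h' ∧
    truncate n h' = truncate n h ∧ ∀ l : List Bool, l.length = n → ∀ c ∈ C, ¬ E (h' 0 l) c

/-- Glue two labellings of level `n` along a new edge labelled `w`. -/
def amalgam (n : ℕ) (h : Bool → Labelling) (w : ℕ → ℕ) : Labelling
  | _, [] => w
  | k, b :: l => if k = n + 1 then w else h b k l

theorem Realizes.amalgam {n : ℕ} {h : Bool → Labelling}
    (hh : ∀ b, Realizes φ s n (h b)) {w : ℕ → ℕ}
    (hw : φ w = (h false 0 (s n), h true 0 (s n))) :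
    Realizes φ s (n + 1) (amalgam n h w) := by
  intro k t hk
  cases t with
  | nil =>
    obtain rfl : k = n := by simpa using hk
    simpa [Labelling.amalgam] using hw
  | cons b t =>
    simp only [List.length_cons] at hk
    have := hh b k t (by omega)
    have hkn : k ≠ n := by omega
    simpa [Labelling.amalgam, hkn] using this


instance (n : ℕ) : Finite {l : List Bool // l.length = n} :=
  (List.finite_length_eq Bool n).to_subtype

/-- There is a countable set that already detects the failure of persistence. -/
theorem exists_countable_forall_persistent (E : (ℕ → ℕ) → (ℕ → ℕ) → Prop)
    (φ : (ℕ → ℕ) → (ℕ → ℕ) × (ℕ → ℕ)) (s : ℕ → List Bool) (n : ℕ) :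
    ∃ C : Set (ℕ → ℕ), C.Countable ∧ ∀ h, Realizes φ s n h →
      (∀ l : List Bool, l.length = n → ∀ c ∈ C, ¬ E (h 0 l) c) → Persistent E φ s n h := by
  have key : ∀ a : Fin (n + 1) → {l : List Bool // l.length = n} → Fin n → ℕ,
      ∃ C : Set (ℕ → ℕ), C.Countable ∧ ∀ h, Realizes φ s n h → truncate n h = a →
      (∀ l : List Bool, l.length = n → ∀ c ∈ C, ¬ E (h 0 l) c) → Persistent E φ s n h := by
    intro a
    by_cases ha : ∃ C : Set (ℕ → ℕ), C.Countable ∧ ¬ ∃ h' : Labelling, Realizes φ s n h' ∧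
      truncate n h' = a ∧ ∀ l : List Bool, l.length = n → ∀ c ∈ C, ¬ E (h' 0 l) c
    · obtain ⟨C, hC, hC'⟩ := ha
      exact ⟨C, hC, fun h h1 h2 h3 => absurd ⟨h, h1, h2, h3⟩ hC'⟩
    · push Not at ha
      refine ⟨∅, countable_empty, fun h _ h2 _ C hC => ?_⟩
      rw [h2]
      exact ha C hC
  choose C hC hC' using key
  refine ⟨⋃ a, C a, countable_iUnion hC, fun h h1 h2 => hC' _ h h1 rfl fun l hl c hc => ?_⟩
  exact h2 l hl c (mem_iUnion_of_mem _ hc)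

theorem exists_persistent_zero
    (hE : ¬ ∃ C : Set (ℕ → ℕ), C.Countable ∧ ∀ x : ℕ → ℕ, ∃ c ∈ C, E x c) :
    ∃ h, Persistent E φ s 0 h := by
  obtain ⟨C, hC, hC'⟩ := exists_countable_forall_persistent E φ s 0
  push Not at hE
  obtain ⟨x, hx⟩ := hE C hC
  exact ⟨fun _ _ => x, hC' _ (fun k t hk => by omega) fun _ _ => hx⟩

theorem Persistent.exists_extension (hφ : range φ = {p | ¬ E p.1 p.2})
    (hsymm : ∀ x y, E x y → E y x) (hs : ∀ n, (s n).length = n) {n : ℕ} {h : Labelling}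
    (hh : Persistent E φ s n h) :
    ∃ h' : Labelling, (Persistent E φ s (n + 1) h' ∧ Realizes φ s (n + 1) h') ∧
      ∀ k ≤ n, ∀ b l, l.length = n → ∀ i < n, h' k (b :: l) i = h k l i := by
  obtain ⟨C, hC, hC'⟩ := exists_countable_forall_persistent E φ s (n + 1)
  obtain ⟨h₀, hr₀, ht₀, ha₀⟩ := hh C hC
  obtain ⟨h₁, hr₁, ht₁, ha₁⟩ := hh (insert (h₀ 0 (s n)) C) (hC.insert _)
  have hne : (h₀ 0 (s n), h₁ 0 (s n)) ∈ range φ := by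
    rw [hφ]
    exact fun hE => ha₁ _ (hs n) _ (mem_insert _ _) (hsymm _ _ hE)
  obtain ⟨w, hw⟩ := hne
  have hr : Realizes φ s (n + 1) (Labelling.amalgam n (fun b => bif b then h₁ else h₀) w) :=
    Realizes.amalgam (by rintro (_ | _) <;> assumption) hw
  refine ⟨_, ⟨hC' _ hr ?_, hr⟩, ?_⟩
  · intro l hl c hc
    match l, hl with
    | false :: l, hl => exact ha₀ l (by simpa using hl) c hc
    | true :: l, hl => exact ha₁ l (by simpa using hl) c (mem_insert_of_mem _ hc)
  · intro k hk b l hl i hi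
    have hk' : k ≠ n + 1 := by omega
    have e (h' : Labelling) (ht : truncate n h' = truncate n h) : h' k l i = h k l i :=
      congrFun (congrFun (congrFun ht ⟨k, by omega⟩) ⟨l, hl⟩) ⟨i, hi⟩
    cases b
    · simpa [Labelling.amalgam, hk'] using e h₀ ht₀
    · simpa [Labelling.amalgam, hk'] using e h₁ ht₁

end Labelling

theorem exists_res_eq_append_cons {s : ℕ → List Bool} {k : ℕ} {x y : ℕ → Bool}
    (hx : res x k = s k) (hxk : x k = false) (hyk : y k = true) (hxy : ∀ i ≠ k, x i = y i)
    {m : ℕ} (hm : k + 1 ≤ m) :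
    ∃ t : List Bool, k + 1 + t.length = m ∧ res x m = t ++ false :: s k ∧
      res y m = t ++ true :: s k := by
  induction m, hm using Nat.le_induction with
  | base =>
    refine ⟨[], rfl, by simp [hx, hxk], ?_⟩
    have : res y k = s k := by
      rw [← hx, res_eq_res]
      exact fun i hi => (hxy i hi.ne).symm
    simp [this, hyk]
  | succ m hm ih =>
    obtain ⟨t, ht, h1, h2⟩ := ih
    refine ⟨x m :: t, by simp only [List.length_cons]; omega, by simp [h1], ?_⟩
    simp [h2, hxy m (by omega)]

/-- The `𝔾₀`-dichotomy for the complement of an equivalence relation with respect to arbitrary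
countable colourings. -/
theorem exists_continuous_hom_of_not_countable {E : (ℕ → ℕ) → (ℕ → ℕ) → Prop}
    (hsymm : ∀ x y, E x y → E y x) {φ : (ℕ → ℕ) → (ℕ → ℕ) × (ℕ → ℕ)} (hφc : Continuous φ)
    (hφ : range φ = {p | ¬ E p.1 p.2}) {s : ℕ → List Bool} (hs : ∀ n, (s n).length = n)
    (hE : ¬ ∃ C : Set (ℕ → ℕ), C.Countable ∧ ∀ x : ℕ → ℕ, ∃ c ∈ C, E x c) :
    ∃ θ : (ℕ → Bool) → ℕ → ℕ, Continuous θ ∧ ∀ k x y, res x k = s k → x k = false → y k = true →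
      (∀ i ≠ k, x i = y i) → ¬ E (θ x) (θ y) := by
  obtain ⟨h₀, hh₀⟩ := Labelling.exists_persistent_zero (φ := φ) (s := s) hE
  have hstep : ∀ n (h : {h // Labelling.Persistent E φ s n h}),
      ∃ h' : {h // Labelling.Persistent E φ s (n + 1) h}, Labelling.Realizes φ s (n + 1) h'.1 ∧
      ∀ k ≤ n, ∀ b l, l.length = n → ∀ i < n, h'.1 k (b :: l) i = h.1 k l i := by
    rintro n ⟨h, hh⟩
    obtain ⟨h', ⟨h1, h2⟩, h3⟩ := hh.exists_extension hφ hsymm hs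
    exact ⟨⟨h', h1⟩, h2, h3⟩
  choose next hnext_real hnext using hstep
  let c' : ∀ n, {h // Labelling.Persistent E φ s n h} := fun n => Nat.rec ⟨h₀, hh₀⟩ next n
  let c : ℕ → Labelling := fun n => (c' n).1
  have hreal : ∀ n, Labelling.Realizes φ s (n + 1) (c (n + 1)) := fun n => hnext_real n (c' n)
  have hc : ∀ n, ∀ k ≤ n, ∀ b l, l.length = n → ∀ i < n, c (n + 1) k (b :: l) i = c n k l i :=
    fun n => hnext n (c' n)
  have hstable : ∀ x k i m₀ m, k ≤ m₀ → i < m₀ → m₀ ≤ m →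
      c m k (res x m) i = c m₀ k (res x m₀) i := by
    intro x k i m₀ m hk hi hm
    induction m, hm using Nat.le_induction with
    | base => rfl
    | succ m hm ih =>
      rw [← ih, res_succ]
      exact hc m k (by omega) _ _ (res_length _ _) i (by omega)
  let lim : ℕ → (ℕ → Bool) → ℕ → ℕ := fun k x i => c (k + i + 1) k (res x (k + i + 1)) i
  have hlim : ∀ k x, Tendsto (fun m => c m k (res x m)) atTop (𝓝 (lim k x)) := by
    intro k x
    rw [tendsto_pi_nhds]
    intro i
    refine tendsto_const_nhds.congr' ?_
    filter_upwards [eventually_ge_atTop (k + i + 1)] with m hm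
    exact (hstable x k i _ m (by omega) (by omega) hm).symm
  refine ⟨lim 0, ?_, ?_⟩
  · refine continuous_pi fun i => ?_
    refine IsLocallyConstant.continuous ((IsLocallyConstant.iff_eventually_eq _).2 fun x => ?_)
    filter_upwards [(isOpen_cylinder _ x (0 + i + 1)).mem_nhds (self_mem_cylinder _ _)] with y hy
    rw [cylinder_eq_res] at hy
    have hy' : res y (0 + i + 1) = res x (0 + i + 1) := hy
    simp only [lim, hy']
  · intro k x y hx hxk hyk hxy
    have h1 := (hφc.tendsto _).comp (hlim (k + 1) y)
    have h2 := (hlim 0 x).prodMk_nhds (hlim 0 y)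
    have h3 : φ (lim (k + 1) y) = (lim 0 x, lim 0 y) := by
      refine tendsto_nhds_unique_of_eventuallyEq h1 h2 ?_
      filter_upwards [eventually_ge_atTop (k + 1)] with m hm
      obtain ⟨t, ht, hxt, hyt⟩ := exists_res_eq_append_cons hx hxk hyk hxy hm
      obtain ⟨m, rfl⟩ : ∃ m', m = m' + 1 := ⟨m - 1, by omega⟩
      simp only [Function.comp, hxt, hyt]
      exact hreal m k t ht
    have h4 : (lim 0 x, lim 0 y) ∈ range φ := ⟨_, h3⟩
    rwa [hφ] at h4

theorem isNowhereDense_frontier {X : Type*} [TopologicalSpace X] {U : Set X} (hU : IsOpen U) :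
    IsNowhereDense (frontier U) := by
  rw [isClosed_frontier.isNowhereDense_iff, ← frontier_compl]
  exact interior_frontier hU.isClosed_compl

/-- Every set has an open hull that is minimal up to meagre sets. -/
theorem exists_isOpen_isMeagre_diff {X : Type*} [TopologicalSpace X] [SecondCountableTopology X]
    (A : Set X) : ∃ H : Set X, IsOpen H ∧ IsMeagre (A \ H) ∧
      ∀ U : Set X, IsOpen U → IsMeagre (A ∩ U) → Disjoint U H := by
  let B := TopologicalSpace.countableBasis X
  have hB := TopologicalSpace.isBasis_countableBasis X
  let V : Set X := ⋃ b ∈ {b ∈ B | IsMeagre (A ∩ b)}, b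
  have hVo : IsOpen V := isOpen_biUnion fun b hb => hB.isOpen hb.1
  have hV : IsMeagre (A ∩ V) := by
    rw [inter_iUnion₂]
    exact isMeagre_biUnion ((TopologicalSpace.countable_countableBasis X).mono (sep_subset _ _))
      fun b hb => hb.2
  refine ⟨interior Vᶜ, isOpen_interior, ?_, ?_⟩
  · refine (hV.union (isNowhereDense_frontier hVo).isMeagre).mono ?_
    rintro x ⟨hxA, hx⟩
    by_cases hxV : x ∈ V
    · exact Or.inl ⟨hxA, hxV⟩
    · right
      rw [← frontier_compl, hVo.isClosed_compl.frontier_eq]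
      exact ⟨hxV, hx⟩
  · intro U hU hUA
    have hUV : U ⊆ V := by
      intro x hx
      obtain ⟨b, hb, hxb, hbU⟩ := hB.exists_subset_of_mem_open hx hU
      exact mem_biUnion (show b ∈ {b ∈ B | IsMeagre (A ∩ b)} from
        ⟨hb, hUA.mono (inter_subset_inter_right _ hbU)⟩) hxb
    exact disjoint_compl_right.mono hUV interior_subset

/-- An analytic set that is non-meagre in every nonempty open set is comeagre. -/
theorem MeasureTheory.AnalyticSet.mem_residual {X : Type*} [TopologicalSpace X]
    [SecondCountableTopology X] [T2Space X] {A : Set X} (hA : AnalyticSet A)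
    (h : ∀ U : Set X, IsOpen U → U.Nonempty → ¬ IsMeagre (A ∩ U)) : A ∈ residual X := by
  rw [AnalyticSet] at hA
  obtain rfl | ⟨f, hf, rfl⟩ := hA
  · rcases isEmpty_or_nonempty X with hX | hX
    · rw [eq_univ_of_forall (s := (∅ : Set X)) (fun x => isEmptyElim x)]
      exact univ_mem
    · exact absurd (by simpa using IsMeagre.empty) (h univ isOpen_univ univ_nonempty)
  let A : List ℕ → Set X := fun l => f '' {α | res α l.length = l}
  choose H hHo hHm hH using fun l => exists_isOpen_isMeagre_diff (A l)
  have hA0 : A [] = range f := by simp [A]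
  have hAsucc : ∀ l, A l ⊆ ⋃ n, A (n :: l) := by
    rintro l _ ⟨α, hα, rfl⟩
    refine mem_iUnion.2 ⟨α l.length, α, ?_, rfl⟩
    simpa using hα
  have hD : ∀ l, IsMeagre (H l \ ⋃ n, H (n :: l)) := by
    intro l
    have hO : IsOpen (⋃ n, H (n :: l)) := isOpen_iUnion fun n => hHo _
    set O := ⋃ n, H (n :: l) with hOdef
    have h1 : IsMeagre (A l ∩ (closure O)ᶜ) := by
      refine (isMeagre_iUnion fun n => hHm (n :: l)).mono ?_
      rintro x ⟨hx, hxO⟩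
      obtain ⟨n, hn⟩ := mem_iUnion.1 (hAsucc l hx)
      exact mem_iUnion.2 ⟨n, hn, fun hxH => hxO (subset_closure (mem_iUnion.2 ⟨n, hxH⟩))⟩
    have h2 := hH l _ isClosed_closure.isOpen_compl h1
    refine (isNowhereDense_frontier hO).isMeagre.mono ?_
    rw [hO.frontier_eq]
    refine sdiff_subset_sdiff_left ?_
    rwa [disjoint_compl_left_iff_subset] at h2
  have hdense : H [] ∈ residual X := by
    refine residual_of_dense_open (hHo _) ?_
    rw [dense_iff_closure_eq, ← compl_empty_iff]
    by_contra hne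
    refine h _ isClosed_closure.isOpen_compl (nonempty_iff_ne_empty.2 hne) ((hHm []).mono ?_)
    rw [hA0]
    exact inter_subset_inter_right _ (compl_subset_compl.2 subset_closure)
  have hmeagre : (⋃ l, H l \ ⋃ n, H (n :: l))ᶜ ∈ residual X := isMeagre_iUnion hD
  filter_upwards [hdense, hmeagre] with x hx0 hx
  have hx' : ∀ l, x ∈ H l → ∃ n, x ∈ H (n :: l) := by simpa using hx
  choose! next hnext using hx'
  let L : ℕ → List ℕ := fun n => Nat.rec [] (fun _ l => next l :: l) n
  have hL : ∀ n, x ∈ H (L n) := fun n => Nat.rec hx0 (fun n ih => hnext _ ih) n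
  let α : ℕ → ℕ := fun n => next (L n)
  have hα : ∀ n, res α n = L n := by
    intro n
    induction n with
    | zero => rfl
    | succ n ih => rw [res_succ, ih]
  refine ⟨α, ?_⟩
  by_contra hne
  obtain ⟨u, v, hu, hv, hαu, hxv, huv⟩ := t2_separation hne
  obtain ⟨_, ⟨y, n, rfl⟩, hαy, hyu⟩ :=
    (isTopologicalBasis_cylinders (fun _ : ℕ => ℕ)).exists_subset_of_mem_open
      (show α ∈ f ⁻¹' u from hαu) (hu.preimage hf)
  refine disjoint_left.1 (hH (L n) v hv ?_) hxv (hL n)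
  convert IsMeagre.empty
  rw [eq_empty_iff_forall_notMem]
  rintro _ ⟨⟨β, hβ, rfl⟩, hβv⟩
  refine disjoint_left.1 huv (hyu ?_) hβv
  rw [cylinder_eq_res] at hαy ⊢
  have h1 : res α n = res y n := hαy
  show res β n = res y n
  rw [← h1, hα]
  have h2 : res β (L n).length = L n := hβ
  rwa [← hα, res_length, hα] at h2

theorem exists_isOpen_subset_forall_prod_subset {X ι : Type*} [TopologicalSpace X]
    {O : Set (X × X)} (hOo : IsOpen O) (hOd : Dense O) (S : Finset (ι × ι)) {U : ι → Set X}
    (hUo : ∀ i, IsOpen (U i)) (hUn : ∀ i, (U i).Nonempty) :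
    ∃ V : ι → Set X, (∀ i, IsOpen (V i)) ∧ (∀ i, (V i).Nonempty) ∧ (∀ i, V i ⊆ U i) ∧
      ∀ p ∈ S, p.1 ≠ p.2 → V p.1 ×ˢ V p.2 ⊆ O := by
  classical
  induction S using Finset.induction_on with
  | empty => exact ⟨U, hUo, hUn, fun _ => Subset.rfl, by simp⟩
  | insert p S _ ih =>
    obtain ⟨V, hVo, hVn, hVU, hVS⟩ := ih
    by_cases hp : p.1 = p.2
    · refine ⟨V, hVo, hVn, hVU, fun q hq hne => ?_⟩
      rcases Finset.mem_insert.1 hq with rfl | hq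
      · exact absurd hp hne
      · exact hVS q hq hne
    obtain ⟨⟨a, b⟩, hab, habO⟩ := hOd.inter_open_nonempty _ ((hVo p.1).prod (hVo p.2))
      ((hVn p.1).prod (hVn p.2))
    obtain ⟨u, v, hu, hv, hau, hbv, huv⟩ := isOpen_prod_iff.1 hOo a b habO
    let W : ι → Set X := fun i => V i ∩ {x | (i = p.1 → x ∈ u) ∧ (i = p.2 → x ∈ v)}
    have hWV : ∀ i, W i ⊆ V i := fun i => inter_subset_left
    refine ⟨W, fun i => ?_, fun i => ?_, fun i => (hWV i).trans (hVU i), fun q hq hne => ?_⟩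
    · by_cases h1 : i = p.1
      · have h2 : i ≠ p.2 := fun h => hp (h1.symm.trans h)
        simpa [W, ← h1, h2] using (hVo i).inter hu
      · by_cases h2 : i = p.2
        · simpa [W, h1, ← h2] using (hVo i).inter hv
        · simpa [W, h1, h2] using hVo i
    · by_cases h1 : i = p.1
      · subst h1
        exact ⟨a, hab.1, fun _ => hau, fun h => absurd h hp⟩
      · by_cases h2 : i = p.2
        · subst h2
          exact ⟨b, hab.2, fun h => absurd h h1, fun _ => hbv⟩
        · obtain ⟨c, hc⟩ := hVn i
          exact ⟨c, hc, fun h => absurd h h1, fun h => absurd h h2⟩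
    · rcases Finset.mem_insert.1 hq with rfl | hq
      · rintro ⟨x, y⟩ ⟨hx, hy⟩
        exact huv ⟨hx.2.1 rfl, hy.2.2 rfl⟩
      · exact (prod_mono (hWV _) (hWV _)).trans (hVS q hq hne)

theorem exists_isOpen_closure_subset_ediam_le {X : Type*} [MetricSpace X] {U : Set X}
    (hU : IsOpen U) (hne : U.Nonempty) (n : ℕ) :
    ∃ V : Set X, IsOpen V ∧ V.Nonempty ∧ closure V ⊆ U ∧
      Metric.ediam V ≤ ENNReal.ofReal (2 * (1 / 2) ^ n) := by
  obtain ⟨x, hx⟩ := hne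
  obtain ⟨ε, hε, hεU⟩ := Metric.isOpen_iff.1 hU x hx
  have hδ : 0 < min (ε / 2) ((1 / 2) ^ n) := by positivity
  refine ⟨Metric.ball x (min (ε / 2) ((1 / 2) ^ n)), Metric.isOpen_ball,
    ⟨x, Metric.mem_ball_self hδ⟩, ?_, ?_⟩
  · refine Metric.closure_ball_subset_closedBall.trans
      ((Metric.closedBall_subset_ball ?_).trans hεU)
    exact (min_le_left _ _).trans_lt (by linarith)
  · rw [← Metric.eball_ofReal]
    refine Metric.ediam_eball_le.trans ?_
    rw [ENNReal.ofReal_mul (by norm_num)]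
    simp only [ENNReal.ofReal_ofNat]
    gcongr
    exact min_le_right _ _

/-- **Mycielski's theorem**: a comeagre relation on a complete metric space holds between any two
distinct members of some continuous family indexed by the Cantor space. -/
theorem exists_continuous_pairwise_of_mem_residual {X : Type*} [MetricSpace X] [CompleteSpace X]
    [Nonempty X] {A : Set (X × X)} (hA : A ∈ residual (X × X)) :
    ∃ ψ : (ℕ → Bool) → X, Continuous ψ ∧ ∀ x y, x ≠ y → (ψ x, ψ y) ∈ A := by
  obtain ⟨T, hTA, hTG, hTd⟩ := mem_residual.1 hA
  obtain ⟨O, hOo, rfl⟩ := isGδ_iff_eq_iInter_nat.1 hTG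
  have hOd : ∀ n, Dense (O n) := fun n => hTd.mono (iInter_subset _ _)
  let P : (List Bool → Set X) → Prop := fun U => (∀ l, IsOpen (U l)) ∧ ∀ l, (U l).Nonempty
  have hstep : ∀ n (U : {U // P U}), ∃ V : {U // P U},
      (∀ b l, closure (V.1 (b :: l)) ⊆ U.1 l) ∧
      (∀ l, Metric.ediam (V.1 l) ≤ ENNReal.ofReal (2 * (1 / 2) ^ n)) ∧
      ∀ m ≤ n, ∀ l l' : List Bool, l.length = n + 1 → l'.length = n + 1 → l ≠ l' →
        V.1 l ×ˢ V.1 l' ⊆ O m := by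
    rintro n ⟨U, hUo, hUn⟩
    choose V hVo hVn hVU hVd using fun l : List Bool =>
      exists_isOpen_closure_subset_ediam_le (hUo l.tail) (hUn l.tail) n
    have hfin := (List.finite_length_eq Bool (n + 1)).prod (List.finite_length_eq Bool (n + 1))
    have hOo' : IsOpen (⋂ m ∈ Iic n, O m) := (finite_Iic n).isOpen_biInter fun m _ => hOo m
    have hOd' : Dense (⋂ m ∈ Iic n, O m) := hTd.mono fun x hx =>
      mem_iInter₂.2 fun m _ => mem_iInter.1 hx m
    obtain ⟨W, hWo, hWn, hWV, hW⟩ := exists_isOpen_subset_forall_prod_subset hOo' hOd'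
      hfin.toFinset hVo hVn
    refine ⟨⟨W, hWo, hWn⟩, fun b l => (closure_mono (hWV _)).trans (hVU _), fun l =>
      (Metric.ediam_mono (hWV l)).trans (hVd l), fun m hm l l' hl hl' hne => ?_⟩
    exact (hW (l, l') (by simp [hl, hl']) hne).trans (biInter_subset_of_mem hm)
  choose next hnext_cl hnext_diam hnext_O using hstep
  let c : ℕ → {U // P U} := fun n =>
    Nat.rec ⟨fun _ => univ, fun _ => isOpen_univ, fun _ => univ_nonempty⟩ next n
  let D : List Bool → Set X := fun l => (c l.length).1 l
  have hanti : CantorScheme.ClosureAntitone D := fun l b => hnext_cl l.length (c l.length) b l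
  have hdiam : CantorScheme.VanishingDiam D := by
    intro x
    have h0 : Tendsto (fun n : ℕ => ENNReal.ofReal (2 * (1 / 2) ^ n)) atTop (𝓝 0) := by
      rw [← ENNReal.ofReal_zero]
      refine ENNReal.tendsto_ofReal ?_
      simpa using (tendsto_pow_atTop_nhds_zero_of_lt_one (r := (1 / 2 : ℝ)) (by norm_num)
        (by norm_num)).const_mul 2
    refine (tendsto_add_atTop_iff_nat 1).1
      (tendsto_of_tendsto_of_tendsto_of_le_of_le tendsto_const_nhds h0 (fun _ => zero_le)
        fun n => ?_)
    simp only [D, res_length]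
    exact hnext_diam n (c n) _
  have hdom := hanti.map_of_vanishingDiam hdiam fun l => (c l.length).2.2 l
  have hmem : ∀ x, x ∈ (CantorScheme.inducedMap D).1 := fun x => hdom ▸ mem_univ x
  refine ⟨fun x => (CantorScheme.inducedMap D).2 ⟨x, hmem x⟩,
    hdiam.map_continuous.comp (by fun_prop), fun x y hxy => hTA (mem_iInter.2 fun m => ?_)⟩
  obtain ⟨i, hi⟩ := Function.ne_iff.1 hxy
  let n := max m i
  have hne : res x (n + 1) ≠ res y (n + 1) := fun h =>
    hi (res_eq_res.1 h (Nat.lt_succ_of_le (le_max_right m i)))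
  refine hnext_O n (c n) m (le_max_left m i) (res x (n + 1)) (res y (n + 1)) (res_length _ _)
    (res_length _ _) hne ⟨?_, ?_⟩
  · simpa only [D, res_length] using CantorScheme.map_mem ⟨x, hmem x⟩ (n + 1)
  · simpa only [D, res_length] using CantorScheme.map_mem ⟨y, hmem y⟩ (n + 1)

theorem res_eq_of_res_eq_append {α : Type*} {x : ℕ → α} {k n : ℕ} {l w : List α}
    (hl : l.length = n) (h : res x k = w ++ l) : res x n = l := by
  induction w generalizing k with
  | nil =>
    obtain rfl : k = n := by simpa [hl] using congrArg List.length h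
    exact h
  | cons a w ih =>
    cases k with
    | zero => simp at h
    | succ k => exact ih (List.cons.inj h).2

theorem exists_res_eq {α : Type*} [Inhabited α] (l : List α) : ∃ x : ℕ → α, res x l.length = l := by
  induction l with
  | nil => exact ⟨default, rfl⟩
  | cons a l ih =>
    obtain ⟨x, hx⟩ := ih
    refine ⟨Function.update x l.length a, ?_⟩
    rw [List.length_cons, res_succ, Function.update_self]
    congr 1
    conv_rhs => rw [← hx]
    rw [res_eq_res]
    exact fun m hm => Function.update_of_ne hm.ne _ _

/-- There is a sequence of words, one of each length, extending every finite word. -/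
theorem exists_dense_words : ∃ s : ℕ → List Bool, (∀ n, (s n).length = n) ∧
    ∀ t, ∃ n w, s n = w ++ t := by
  obtain ⟨e, he⟩ := exists_surjective_nat (List Bool)
  have key : ∀ n, ∃ l : List Bool, l.length = n ∧
      ((e n.unpair.1).length ≤ n → ∃ w, l = w ++ e n.unpair.1) := by
    intro n
    by_cases hn : (e n.unpair.1).length ≤ n
    · exact ⟨List.replicate (n - (e n.unpair.1).length) false ++ e n.unpair.1, by simp [hn],
        fun _ => ⟨_, rfl⟩⟩
    · exact ⟨List.replicate n false, by simp, fun h => absurd h hn⟩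
  choose s hs hs' using key
  refine ⟨s, hs, fun t => ?_⟩
  obtain ⟨i, rfl⟩ := he t
  refine ⟨Nat.pair i (e i).length, ?_⟩
  simpa using hs' (Nat.pair i (e i).length) (by simpa using Nat.right_le_pair _ _)

/-- Flipping the `k`-th coordinate of a binary sequence. -/
def flipCoord (k : ℕ) : (ℕ → Bool) ≃ₜ (ℕ → Bool) :=
  Homeomorph.piCongrRight fun i => if i = k then
    (Equiv.boolNot.toHomeomorphOfDiscrete) else Homeomorph.refl Bool

theorem flipCoord_self (k : ℕ) (x : ℕ → Bool) : flipCoord k x k = !x k := by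
  simp only [flipCoord, Homeomorph.piCongrRight_apply, if_true]
  rfl

theorem flipCoord_of_ne {i k : ℕ} (h : i ≠ k) (x : ℕ → Bool) : flipCoord k x i = x i := by
  simp [flipCoord, Homeomorph.piCongrRight, h]

/-- The pullback of the complement of an equivalence relation along a homomorphism from `𝔾₀` is
non-meagre in every nonempty open set. -/
theorem not_isMeagre_inter_of_hom {E : (ℕ → ℕ) → (ℕ → ℕ) → Prop} (hE : Equivalence E)
    {s : ℕ → List Bool} (hs : ∀ n, (s n).length = n) (hsd : ∀ t, ∃ n w, s n = w ++ t)
    {θ : (ℕ → Bool) → ℕ → ℕ} (hθ : ∀ k x y, res x k = s k → x k = false → y k = true →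
      (∀ i ≠ k, x i = y i) → ¬ E (θ x) (θ y))
    {U : Set ((ℕ → Bool) × (ℕ → Bool))} (hU : IsOpen U) (hne : U.Nonempty) :
    ¬ IsMeagre ({p | ¬ E (θ p.1) (θ p.2)} ∩ U) := by
  intro hm
  obtain ⟨⟨a, b⟩, hab⟩ := hne
  obtain ⟨u, v, hu, hv, hau, hbv, huv⟩ := isOpen_prod_iff.1 hU a b hab
  obtain ⟨_, ⟨y, n, rfl⟩, hby, hyv⟩ :=
    (isTopologicalBasis_cylinders (fun _ : ℕ => Bool)).exists_subset_of_mem_open hbv hv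
  obtain ⟨k, w, hk⟩ := hsd (res y n)
  obtain ⟨z, hz⟩ := exists_res_eq (s k)
  rw [hs] at hz
  have hcyl : ∀ x ∈ cylinder z k, res x k = s k ∧ x ∈ v := by
    intro x hx
    rw [cylinder_eq_res] at hx
    have hx' : res x k = s k := Eq.trans hx hz
    refine ⟨hx', hyv ?_⟩
    rw [cylinder_eq_res]
    exact res_eq_of_res_eq_append (res_length _ _) (hx'.trans hk)
  let σ := (Homeomorph.refl (ℕ → Bool)).prodCongr (flipCoord k)
  have hmσ := hm.preimage_of_isOpenMap σ.continuous σ.isOpenMap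
  obtain ⟨⟨x, y⟩, ⟨hxu, hyz⟩, hxy⟩ := (dense_of_mem_residual (hm.union hmσ)).inter_open_nonempty
    (u ×ˢ cylinder z k) (hu.prod (isOpen_cylinder _ _ _)) ⟨(a, z), hau, self_mem_cylinder _ _⟩
  have hyz' : flipCoord k y ∈ cylinder z k := fun i hi => by
    rw [flipCoord_of_ne hi.ne]
    exact hyz i hi
  have h1 : E (θ x) (θ y) := by
    by_contra h
    exact hxy (Or.inl ⟨h, huv ⟨hxu, (hcyl y hyz).2⟩⟩)
  have h2 : E (θ x) (θ (flipCoord k y)) := by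
    by_contra h
    exact hxy (Or.inr ⟨h, huv ⟨hxu, (hcyl _ hyz').2⟩⟩)
  have h3 := hE.trans (hE.symm h1) h2
  cases hyk : y k
  · exact hθ k y (flipCoord k y) (hcyl y hyz).1 hyk (by simp [flipCoord_self, hyk])
      (fun i hi => (flipCoord_of_ne hi y).symm) h3
  · exact hθ k (flipCoord k y) y (hcyl _ hyz').1 (by simp [flipCoord_self, hyk]) hyk
      (fun i hi => flipCoord_of_ne hi y) (hE.symm h3)

theorem perfect_range_of_injective {X : Type*} [TopologicalSpace X] [T2Space X]
    {f : (ℕ → Bool) → X} (hf : Continuous f) (hinj : Function.Injective f) :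
    Perfect (range f) := by
  refine ⟨(isCompact_range hf).isClosed, ?_⟩
  rw [preperfect_iff_nhds]
  rintro _ ⟨x, rfl⟩ U hU
  obtain ⟨_, ⟨y, n, rfl⟩, hxy, hyU⟩ :=
    (isTopologicalBasis_cylinders (fun _ : ℕ => Bool)).mem_nhds_iff.1 (hf.continuousAt hU)
  have hne : flipCoord n x ≠ x := fun h => by
    simpa [flipCoord_self] using congrFun h n
  refine ⟨f (flipCoord n x), ⟨hyU fun i hi => ?_, mem_range_self _⟩, hinj.ne hne⟩
  rw [flipCoord_of_ne hi.ne]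
  exact hxy i hi

/-- Silver dichotomy: if `E` is an equivalence relation on Baire space
`ℕ → ℕ` whose complement is analytic (i.e. `E` is coanalytic), then either `E` has at
most countably many classes, or there is a nonempty perfect set of pairwise
`E`-inequivalent points. -/
theorem silver_dichotomy
    (E : (ℕ → ℕ) → (ℕ → ℕ) → Prop) (hE : Equivalence E)
    (hcoanalytic : AnalyticSet {p : (ℕ → ℕ) × (ℕ → ℕ) | ¬ E p.1 p.2}) :
    (∃ C : Set (ℕ → ℕ), C.Countable ∧ ∀ x : ℕ → ℕ, ∃ c ∈ C, E x c) ∨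
    (∃ P : Set (ℕ → ℕ), P.Nonempty ∧ Perfect P ∧
      ∀ x ∈ P, ∀ y ∈ P, x ≠ y → ¬ E x y) := by
  refine or_iff_not_imp_left.2 fun hC => ?_
  have hcoanalytic' := hcoanalytic
  rw [AnalyticSet] at hcoanalytic
  obtain hempty | ⟨φ, hφc, hφ⟩ := hcoanalytic
  · refine absurd ⟨{0}, countable_singleton 0, fun x => ⟨0, rfl, ?_⟩⟩ hC
    by_contra h
    exact (hempty ▸ h : (x, (0 : ℕ → ℕ)) ∈ (∅ : Set ((ℕ → ℕ) × (ℕ → ℕ))))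
  obtain ⟨s, hs, hsd⟩ := exists_dense_words
  obtain ⟨θ, hθc, hθ⟩ :=
    exists_continuous_hom_of_not_countable (fun _ _ => hE.symm) hφc hφ hs hC
  have : PolishSpace ((ℕ → Bool) × (ℕ → Bool)) := { }
  have hA : AnalyticSet {p : (ℕ → Bool) × (ℕ → Bool) | ¬ E (θ p.1) (θ p.2)} :=
    hcoanalytic'.preimage (hθc.prodMap hθc)
  have hres := hA.mem_residual fun U hU hne => not_isMeagre_inter_of_hom hE hs hsd hθ hU hne
  let := TopologicalSpace.upgradeIsCompletelyMetrizable (ℕ → Bool)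
  obtain ⟨ψ, hψc, hψ⟩ := exists_continuous_pairwise_of_mem_residual hres
  have hinj : Function.Injective (θ ∘ ψ) := by
    intro x y hxy
    by_contra hne
    have h1 : ¬ E (θ (ψ x)) (θ (ψ y)) := hψ x y hne
    exact h1 ((show θ (ψ x) = θ (ψ y) from hxy) ▸ hE.refl _)
  refine ⟨range (θ ∘ ψ), range_nonempty _, perfect_range_of_injective (hθc.comp hψc) hinj, ?_⟩
  rintro _ ⟨x, rfl⟩ _ ⟨y, rfl⟩ hne
  exact hψ x y fun h => hne (h ▸ rfl)
end

section
/- Let E be a Borel equivalence relation on a Polish space X. Then either E is smooth, i.e., there is a Borel-measurable map θ : X → 2^ℕ with x E y ↔ θ(x) = θ(y) for all x, y ∈ X, or there exists a continuous injection f : 2^ℕ → X such that for all a, b ∈ 2^ℕ: a E₀ b ↔ f(a) E f(b). -/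
open MeasureTheory
/-- `E₀`: eventual equality on Cantor space `2^ℕ`. -/
def E0 (x y : ℕ → Bool) : Prop := {n : ℕ | x n ≠ y n}.Finite

namespace GlimmEffros

open Set Filter Topology

section Separation

variable {X : Type*} [MeasurableSpace X] {E R : X → X → Prop}

/-- The set of points `R`-related to some point of `A`. -/
def relImage (R : X → X → Prop) (A : Set X) : Set X := {y | ∃ x ∈ A, R x y}

/-- Membership in `A` depends only on the `E`-class. -/
def Invariant (E : X → X → Prop) (A : Set X) : Prop := ∀ x y, E x y → (x ∈ A ↔ y ∈ A)

/-- `x` and `y` belong to the same members of the family `𝒞`. -/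
def Indist (𝒞 : Set (Set X)) (x y : X) : Prop := ∀ A ∈ 𝒞, (x ∈ A ↔ y ∈ A)

/-- A countable family of Borel `E`-invariant sets. -/
structure IsInvariantFamily (E : X → X → Prop) (𝒞 : Set (Set X)) : Prop where
  countable : 𝒞.Countable
  measurableSet : ∀ A ∈ 𝒞, MeasurableSet A
  invariant : ∀ A ∈ 𝒞, Invariant E A

lemma IsInvariantFamily.insert {𝒞 : Set (Set X)} (h : IsInvariantFamily E 𝒞) {D : Set X}
    (hD : MeasurableSet D) (hDE : Invariant E D) : IsInvariantFamily E (insert D 𝒞) where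
  countable := h.countable.insert D
  measurableSet := by rintro A (rfl | hA); exacts [hD, h.measurableSet A hA]
  invariant := by rintro A (rfl | hA); exacts [hDE, h.invariant A hA]

lemma IsInvariantFamily.indist {𝒞 : Set (Set X)} (h : IsInvariantFamily E 𝒞) {x y : X}
    (hxy : E x y) : Indist 𝒞 x y := fun A hA => h.invariant A hA x y hxy

lemma IsInvariantFamily.measurableSet_indist {𝒞 : Set (Set X)} (h : IsInvariantFamily E 𝒞) :
    MeasurableSet {p : X × X | Indist 𝒞 p.1 p.2} := by
  have : {p : X × X | Indist 𝒞 p.1 p.2} =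
      ⋂ A ∈ 𝒞, {p : X × X | p.1 ∈ A ↔ p.2 ∈ A} := by
    ext p; simp [Indist]
  rw [this]
  refine MeasurableSet.biInter h.countable fun A hA => ?_
  have hA := h.measurableSet A hA
  exact (measurableSet_setOfPred.1 (measurable_fst hA)).iff
    (measurableSet_setOfPred.1 (measurable_snd hA)) |>.setOf

variable [TopologicalSpace X] [PolishSpace X] [BorelSpace X]

lemma analyticSet_relImage (hR : MeasurableSet {p : X × X | R p.1 p.2}) {A : Set X}
    (hA : AnalyticSet A) : AnalyticSet (relImage R A) := by
  obtain ⟨β, _, _, g, hg, rfl⟩ := analyticSet_iff_exists_polishSpace_range.1 hA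
  borelize β
  have hm : Measurable fun p : β × X => (g p.1, p.2) := by
    have := hg.measurable
    fun_prop
  have := (hm hR).analyticSet_image (f := (Prod.snd : β × X → X)) measurable_snd
  convert this using 1
  ext y
  simp [relImage]

/-- Analytic sets with disjoint saturations are separated by an invariant Borel set. -/
lemma exists_invariant_separation (hE : Equivalence E)
    (hB : MeasurableSet {p : X × X | E p.1 p.2}) {A A' : Set X} (hA : AnalyticSet A)
    (hA' : AnalyticSet A') (h : ∀ x ∈ A, ∀ y ∈ A', ¬ E x y) :
    ∃ D, MeasurableSet D ∧ Invariant E D ∧ A ⊆ D ∧ Disjoint D A' := by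
  have step : ∀ B : Set X, AnalyticSet B → Disjoint B (relImage E A') →
      ∃ D, MeasurableSet D ∧ Disjoint D (relImage E A') ∧ relImage E B ⊆ D := by
    intro B hBa hd
    obtain ⟨D, h1, h2, h3⟩ := (analyticSet_relImage hB hBa).measurablySeparable
      (analyticSet_relImage hB hA') (by
        rw [Set.disjoint_left] at hd ⊢
        rintro y ⟨x, hx, hxy⟩ ⟨z, hz, hzy⟩
        exact hd hx ⟨z, hz, hE.trans hzy (hE.symm hxy)⟩)
    exact ⟨D, h3, h2.symm, h1⟩
  obtain ⟨D0, hD0, hd0, hs0⟩ := step A hA (by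
    rw [Set.disjoint_left]
    rintro x hx ⟨y, hy, hyx⟩
    exact h x hx y hy (hE.symm hyx))
  choose! F hF1 hF2 hF3 using step
  let D : ℕ → Set X := fun n => F^[n] D0
  have hD : ∀ n, MeasurableSet (D n) ∧ Disjoint (D n) (relImage E A') := by
    intro n
    induction n with
    | zero => exact ⟨hD0, hd0⟩
    | succ n ih =>
      simp only [D, Function.iterate_succ_apply']
      exact ⟨hF1 _ ih.1.analyticSet ih.2, hF2 _ ih.1.analyticSet ih.2⟩
  have hsub : ∀ n, relImage E (D n) ⊆ D (n + 1) := by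
    intro n
    simp only [D, Function.iterate_succ_apply']
    exact hF3 _ (hD n).1.analyticSet (hD n).2
  have hdir : ∀ x y, E x y → x ∈ ⋃ n, D n → y ∈ ⋃ n, D n := by
    intro x y hxy hx
    obtain ⟨n, hn⟩ := mem_iUnion.1 hx
    exact mem_iUnion.2 ⟨n + 1, hsub n ⟨x, hn, hxy⟩⟩
  refine ⟨⋃ n, D n, .iUnion fun n => (hD n).1, fun x y hxy =>
    ⟨hdir x y hxy, hdir y x (hE.symm hxy)⟩, fun x hx => ?_, ?_⟩
  · exact mem_iUnion.2 ⟨0, hs0 ⟨x, hx, hE.refl x⟩⟩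
  · rw [Set.disjoint_iUnion_left]
    exact fun n => (hD n).2.mono_right (show A' ⊆ relImage E A' from fun y hy => ⟨y, hy, hE.refl y⟩)

/-- An analytic set on which indistinguishability implies `E` is contained in an
invariant Borel set with the same property. -/
lemma exists_invariant_reflection (hE : Equivalence E)
    (hB : MeasurableSet {p : X × X | E p.1 p.2}) {𝒞 : Set (Set X)} (h𝒞 : IsInvariantFamily E 𝒞)
    {A : Set X} (hA : AnalyticSet A) (h : ∀ x ∈ A, ∀ y ∈ A, Indist 𝒞 x y → E x y) :
    ∃ D, MeasurableSet D ∧ Invariant E D ∧ A ⊆ D ∧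
      ∀ x ∈ D, ∀ y ∈ D, Indist 𝒞 x y → E x y := by
  let R : X → X → Prop := fun x y => Indist 𝒞 x y ∧ ¬ E x y
  have hR : MeasurableSet {p : X × X | R p.1 p.2} := h𝒞.measurableSet_indist.inter hB.compl
  have tr : ∀ {x y z}, Indist 𝒞 x y → Indist 𝒞 y z → Indist 𝒞 x z :=
    fun h1 h2 A hA => (h1 A hA).trans (h2 A hA)
  have sy : ∀ {x y}, Indist 𝒞 x y → Indist 𝒞 y x := fun h1 A hA => (h1 A hA).symm
  obtain ⟨C, hC, hCi, hAC, hCd⟩ := exists_invariant_separation hE hB hA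
    (analyticSet_relImage hR hA) (by
      rintro x hx y ⟨x0, hx0, h1, h2⟩ hxy
      exact h2 (hE.trans (h x0 hx0 x hx (tr h1 (sy (h𝒞.indist hxy)))) hxy))
  obtain ⟨D, hD, hDi, hAD, hDd⟩ := exists_invariant_separation hE hB hA
    (analyticSet_relImage hR hC.analyticSet) (by
      rintro x hx y ⟨c, hc, h1, h2⟩ hxy
      refine Set.disjoint_left.1 hCd hc ⟨x, hx, tr (h𝒞.indist hxy) (sy h1), fun hxc => ?_⟩
      exact h2 (hE.trans (hE.symm hxc) hxy))
  refine ⟨C ∩ D, hC.inter hD, fun x y hxy => and_congr (hCi x y hxy) (hDi x y hxy),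
    subset_inter hAC hAD, fun x hx y hy hxy => ?_⟩
  by_contra hn
  exact Set.disjoint_left.1 hDd hy.2 ⟨x, hx.1, hxy, hn⟩

end Separation

section Config

/-- A configuration of level `n` consists of `2 ^ n` points of `X` together with witnesses in `W`
for the edges joining them. -/
def Config (X : Type*) (W : Type) : ℕ → Type _
  | 0 => X
  | n + 1 => Config X W n × Config X W n × W

variable {X : Type*} {W : Type}

/-- The point with index `z` of a configuration of level `n`; only `z 0, …, z (n - 1)` matter. -/
def pt : ∀ n, Config X W n → (ℕ → Bool) → X
  | 0, c, _ => c
  | n + 1, c, z => if z n then pt n c.2.1 z else pt n c.1 z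

/-- The points of a configuration. -/
def pts : ∀ n, Config X W n → Set X
  | 0, c => {c}
  | n + 1, c => pts n c.1 ∪ pts n c.2.1

/-- The witness for the edge of level `k < n` with index `z`. -/
def wit [Inhabited W] : ∀ n, Config X W n → ℕ → (ℕ → Bool) → W
  | 0, _, _, _ => default
  | n + 1, c, k, z => if k = n then c.2.2 else
      if z n then wit n c.2.1 k z else wit n c.1 k z

lemma pt_mem_pts : ∀ (n : ℕ) (c : Config X W n) (z : ℕ → Bool), pt n c z ∈ pts n c
  | 0, _, _ => rfl
  | n + 1, c, z => by
    rw [pt, pts]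
    split_ifs
    exacts [Or.inr (pt_mem_pts n _ z), Or.inl (pt_mem_pts n _ z)]

lemma pt_succ (n : ℕ) (c : Config X W (n + 1)) (z : ℕ → Bool) :
    pt (n + 1) c z = if z n then pt n c.2.1 z else pt n c.1 z := rfl

lemma pt_congr : ∀ (n : ℕ) (c : Config X W n) {z z' : ℕ → Bool} (_ : ∀ i < n, z i = z' i),
    pt n c z = pt n c z'
  | 0, _, _, _, _ => rfl
  | n + 1, c, z, z', h => by
    have h' : ∀ i < n, z i = z' i := fun i hi => h i (by omega)
    rw [pt, pt, h n (by omega), pt_congr n _ h', pt_congr n _ h']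

/-- Every member of `𝒞` contains either all points of the configuration or none. -/
def Compat (𝒞 : Set (Set X)) (n : ℕ) (c : Config X W n) : Prop :=
  ∀ A ∈ 𝒞, pts n c ⊆ A ∨ pts n c ⊆ Aᶜ

lemma Compat.indist {𝒞 : Set (Set X)} {n : ℕ} {c : Config X W n} (h : Compat 𝒞 n c) {x y : X}
    (hx : x ∈ pts n c) (hy : y ∈ pts n c) : Indist 𝒞 x y := by
  intro A hA
  rcases h A hA with h | h
  · exact iff_of_true (h hx) (h hy)
  · exact iff_of_false (h hx) (h hy)

lemma Compat.mono {𝒞 𝒟 : Set (Set X)} (hs : 𝒞 ⊆ 𝒟) {n : ℕ} {c : Config X W n}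
    (h : Compat 𝒟 n c) : Compat 𝒞 n c := fun A hA => h A (hs hA)

lemma Compat.join {𝒞 : Set (Set X)} {n : ℕ} {c c' : Config X W n} (h : Compat 𝒞 n c)
    (h' : Compat 𝒞 n c') {x x' : X} (hx : x ∈ pts n c) (hx' : x' ∈ pts n c')
    (hxx' : Indist 𝒞 x x') (w : W) :
    Compat (X := X) (W := W) 𝒞 (n + 1) (c, c', w) := by
  intro A hA
  rcases h A hA with h | h <;> rcases h' A hA with h' | h'
  · exact Or.inl (union_subset h h')
  · exact absurd ((hxx' A hA).1 (h hx)) (h' hx')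
  · exact absurd ((hxx' A hA).2 (h' hx')) (h hx)
  · exact Or.inr (union_subset h h')

/-- Every countable family of invariant Borel sets is compatible with some member of `S`. -/
def Large [MeasurableSpace X] (E : X → X → Prop) {n : ℕ} (S : Set (Config X W n)) : Prop :=
  ∀ 𝒞, IsInvariantFamily E 𝒞 → ∃ c ∈ S, Compat 𝒞 n c

lemma Large.exists_of_subset_iUnion [MeasurableSpace X] {E : X → X → Prop} {n : ℕ} {S : Set (Config X W n)}
    (hS : Large E S) {ι : Type*} [Countable ι] {T : ι → Set (Config X W n)}
    (hT : S ⊆ ⋃ i, T i) : ∃ i, Large E (S ∩ T i) := by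
  by_contra! hcon
  simp only [Large] at hcon
  push Not at hcon
  choose 𝒞 h𝒞 hbad using hcon
  obtain ⟨c, hc, hcc⟩ := hS (⋃ i, 𝒞 i)
    ⟨countable_iUnion fun i => (h𝒞 i).countable, by
      simp only [mem_iUnion]; rintro A ⟨i, hi⟩; exact (h𝒞 i).measurableSet A hi, by
      simp only [mem_iUnion]; rintro A ⟨i, hi⟩; exact (h𝒞 i).invariant A hi⟩
  obtain ⟨i, hi⟩ := mem_iUnion.1 (hT hc)
  exact hbad i c ⟨hc, hi⟩ (hcc.mono (subset_iUnion 𝒞 i))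

/-- The configurations of level `n + 1` obtained by joining two members of `S` along an edge
between the points with indices `a` and `b`, witnessed through `g`. -/
def split (g : W → X × X) (a b : ℕ → Bool) {n : ℕ} (S : Set (Config X W n)) :
    Set (Config X W (n + 1)) :=
  {c | c.1 ∈ S ∧ c.2.1 ∈ S ∧ g c.2.2 = (pt n c.1 a, pt n c.2.1 b)}

variable [MetricSpace X] [MetricSpace W]

noncomputable instance instMetricConfig : ∀ n, MetricSpace (Config X W n)
  | 0 => inferInstanceAs (MetricSpace X)
  | n + 1 =>
    letI := instMetricConfig n
    inferInstanceAs (MetricSpace (Config X W n × Config X W n × W))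

instance instCompleteConfig [CompleteSpace X] [CompleteSpace W] : ∀ n, CompleteSpace (Config X W n)
  | 0 => inferInstanceAs (CompleteSpace X)
  | n + 1 =>
    haveI := instCompleteConfig n
    inferInstanceAs (CompleteSpace (Config X W n × Config X W n × W))

instance instSecondCountableConfig [SecondCountableTopology X] [SecondCountableTopology W] :
    ∀ n, SecondCountableTopology (Config X W n)
  | 0 => inferInstanceAs (SecondCountableTopology X)
  | n + 1 =>
    haveI := instSecondCountableConfig n
    inferInstanceAs (SecondCountableTopology (Config X W n × Config X W n × W))

noncomputable instance instMeasurableConfig (n : ℕ) : MeasurableSpace (Config X W n) := borel _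

instance instBorelConfig (n : ℕ) : BorelSpace (Config X W n) := ⟨rfl⟩

lemma continuous_left (n : ℕ) : Continuous fun c : Config X W (n + 1) => c.1 :=
  continuous_fst (X := Config X W n) (Y := Config X W n × W)

lemma continuous_right (n : ℕ) : Continuous fun c : Config X W (n + 1) => c.2.1 :=
  continuous_fst.comp (continuous_snd (X := Config X W n) (Y := Config X W n × W))

lemma continuous_witness (n : ℕ) : Continuous fun c : Config X W (n + 1) => c.2.2 :=
  continuous_snd.comp (continuous_snd (X := Config X W n) (Y := Config X W n × W))

lemma dist_left_le {n : ℕ} (c c' : Config X W (n + 1)) : dist c.1 c'.1 ≤ dist c c' :=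
  le_max_left _ _

lemma dist_right_le {n : ℕ} (c c' : Config X W (n + 1)) : dist c.2.1 c'.2.1 ≤ dist c c' :=
  (le_max_left _ _).trans (le_max_right (dist c.1 c'.1) _)

lemma dist_witness_le {n : ℕ} (c c' : Config X W (n + 1)) : dist c.2.2 c'.2.2 ≤ dist c c' :=
  (le_max_right _ _).trans (le_max_right (dist c.1 c'.1) _)

lemma dist_pt_le (z : ℕ → Bool) : ∀ (n : ℕ) (c c' : Config X W n),
    dist (pt n c z) (pt n c' z) ≤ dist c c'
  | 0, _, _ => le_rfl
  | n + 1, c, c' => by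
    rw [pt, pt]
    split_ifs
    exacts [(dist_pt_le z n _ _).trans (dist_right_le c c'),
      (dist_pt_le z n _ _).trans (dist_left_le c c')]

lemma dist_wit_le [Inhabited W] (k : ℕ) (z : ℕ → Bool) : ∀ (n : ℕ) (c c' : Config X W n),
    dist (wit n c k z) (wit n c' k z) ≤ dist c c'
  | 0, _, _ => by simp [wit]
  | n + 1, c, c' => by
    rw [wit, wit]
    split_ifs
    exacts [dist_witness_le c c', (dist_wit_le k z n _ _).trans (dist_right_le c c'),
      (dist_wit_le k z n _ _).trans (dist_left_le c c')]

lemma continuous_pt (n : ℕ) (z : ℕ → Bool) : Continuous fun c : Config X W n => pt n c z :=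
  LipschitzWith.continuous (K := 1) (LipschitzWith.of_dist_le_mul fun c c' => by
    simpa using dist_pt_le z n c c')

lemma measurableSet_split [SecondCountableTopology X] {g : W → X × X} (hg : Continuous g)
    (a b : ℕ → Bool) {n : ℕ} {S : Set (Config X W n)}
    (hS : MeasurableSet S) : MeasurableSet (split g a b S) := by
  refine ((continuous_left n).measurable hS).inter
    (((continuous_right n).measurable hS).inter (IsClosed.measurableSet ?_))
  exact isClosed_eq (hg.comp (continuous_witness n))
    (((continuous_pt n a).comp (continuous_left n)).prodMk
      ((continuous_pt n b).comp (continuous_right n)))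

variable [MeasurableSpace X] [BorelSpace X]

lemma measurableSet_pts_subset {A : Set X} (hA : MeasurableSet A) :
    ∀ n, MeasurableSet {c : Config X W n | pts n c ⊆ A}
  | 0 => by
    have : {c : Config X W 0 | pts 0 c ⊆ A} = (fun c => pt 0 c fun _ => false) ⁻¹' A := by
      ext c; exact singleton_subset_iff
    rw [this]
    exact (continuous_pt 0 _).measurable hA
  | n + 1 => by
    simp only [pts, union_subset_iff]
    exact ((continuous_left n).measurable (measurableSet_pts_subset hA n)).inter
      ((continuous_right n).measurable (measurableSet_pts_subset hA n))

lemma measurableSet_compat {E : X → X → Prop} {𝒞 : Set (Set X)} (h : IsInvariantFamily E 𝒞)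
    (n : ℕ) : MeasurableSet {c : Config X W n | Compat 𝒞 n c} := by
  have : {c : Config X W n | Compat 𝒞 n c} =
      ⋂ A ∈ 𝒞, ({c : Config X W n | pts n c ⊆ A} ∪ {c : Config X W n | pts n c ⊆ Aᶜ}) := by
    ext c; simp [Compat]
  rw [this]
  exact MeasurableSet.biInter h.countable fun A hA =>
    (measurableSet_pts_subset (h.measurableSet A hA) n).union
      (measurableSet_pts_subset (h.measurableSet A hA).compl n)

lemma analyticSet_pt_image [CompleteSpace X] [CompleteSpace W] [SecondCountableTopology X]
    [SecondCountableTopology W] {E : X → X → Prop} {𝒞 : Set (Set X)} (h : IsInvariantFamily E 𝒞)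
    {n : ℕ} {S : Set (Config X W n)} (hS : MeasurableSet S) (a : ℕ → Bool) :
    AnalyticSet ((fun c => pt n c a) '' (S ∩ {c | Compat 𝒞 n c})) :=
  (hS.inter (measurableSet_compat h n)).analyticSet_image (continuous_pt n a).measurable

variable [CompleteSpace X] [CompleteSpace W] [SecondCountableTopology X]
    [SecondCountableTopology W] {E : X → X → Prop} {g : W → X × X} {n : ℕ}
    {S : Set (Config X W n)}

lemma Large.split_of_not_rel (hE : Equivalence E) (hB : MeasurableSet {p : X × X | E p.1 p.2})
    (hg : range g = {p : X × X | ¬ E p.1 p.2}) (hS : MeasurableSet S) (hL : Large E S)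
    (hne : ∀ c ∈ S, ∃ x ∈ pts n c, ∃ y ∈ pts n c, ¬ E x y) (a : ℕ → Bool) :
    Large E (split g a a S) := by
  intro 𝒞 h𝒞
  by_contra! hcon
  obtain ⟨D, hD, hDi, hAD, hDE⟩ := exists_invariant_reflection hE hB h𝒞
    (analyticSet_pt_image h𝒞 hS a) (by
      rintro _ ⟨c, ⟨hc, hcc⟩, rfl⟩ _ ⟨c', ⟨hc', hcc'⟩, rfl⟩ hind
      by_contra hn
      obtain ⟨w, hw⟩ : (pt n c a, pt n c' a) ∈ range g := by rw [hg]; exact hn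
      exact hcon (c, c', w) ⟨hc, hc', hw⟩
        (hcc.join hcc' (pt_mem_pts n c a) (pt_mem_pts n c' a) hind w))
  obtain ⟨c, hc, hcc⟩ := hL _ (h𝒞.insert hD hDi)
  have hcc' : Compat 𝒞 n c := hcc.mono (subset_insert D 𝒞)
  have hmem : pt n c a ∈ D := hAD ⟨c, ⟨hc, hcc'⟩, rfl⟩
  have hall : ∀ x ∈ pts n c, x ∈ D := fun x hx =>
    (hcc.indist (pt_mem_pts n c a) hx D (mem_insert D 𝒞)).1 hmem
  obtain ⟨x, hx, y, hy, hxy⟩ := hne c hc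
  exact hxy (hDE x (hall x hx) y (hall y hy) (hcc'.indist hx hy))

lemma Large.split_of_rel (hE : Equivalence E) (hB : MeasurableSet {p : X × X | E p.1 p.2})
    (hg : range g = {p : X × X | E p.1 p.2}) (hS : MeasurableSet S) (hL : Large E S)
    (a b : ℕ → Bool) : Large E (split g a b S) := by
  intro 𝒞 h𝒞
  by_contra! hcon
  obtain ⟨D, hD, hDi, hAD, hDA⟩ := exists_invariant_separation hE hB
    (analyticSet_pt_image h𝒞 hS a) (analyticSet_pt_image h𝒞 hS b) (by
      rintro _ ⟨c, ⟨hc, hcc⟩, rfl⟩ _ ⟨c', ⟨hc', hcc'⟩, rfl⟩ hxy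
      obtain ⟨w, hw⟩ : (pt n c a, pt n c' b) ∈ range g := by rw [hg]; exact hxy
      exact hcon (c, c', w) ⟨hc, hc', hw⟩
        (hcc.join hcc' (pt_mem_pts n c a) (pt_mem_pts n c' b) (h𝒞.indist hxy) w))
  obtain ⟨c, hc, hcc⟩ := hL _ (h𝒞.insert hD hDi)
  have hcc' : Compat 𝒞 n c := hcc.mono (subset_insert D 𝒞)
  have hmem : pt n c a ∈ D := hAD ⟨c, ⟨hc, hcc'⟩, rfl⟩
  exact Set.disjoint_left.1 hDA ((hcc.indist (pt_mem_pts n c a) (pt_mem_pts n c b) D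
    (mem_insert D 𝒞)).1 hmem) ⟨c, ⟨hc, hcc'⟩, rfl⟩

end Config

section Fusion

variable {X : Type*} {W : Type} [MetricSpace X] [MetricSpace W] {E : X → X → Prop}
  {g : ℕ → W → X × X} {a b : ℕ → ℕ → Bool}

lemma exists_limit_of_scheme {Y : Type*} [MetricSpace Y] [CompleteSpace Y]
    {S : ∀ n, Set (Config X W n)} (hne : ∀ n, (S n).Nonempty)
    (hS : ∀ n, S (n + 1) ⊆ split (g n) (a n) (b n) (S n))
    (hd : ∀ n, ∀ c ∈ S (n + 1), ∀ c' ∈ S (n + 1), dist c c' ≤ (1 / 2 : ℝ) ^ n)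
    (p : ∀ n, Config X W n → Y) (hp : ∀ n c c', dist (p n c) (p n c') ≤ dist c c') (k : ℕ)
    (hred : ∀ n ≥ k, ∀ c : Config X W (n + 1), p (n + 1) c = p n c.1 ∨ p (n + 1) c = p n c.2.1) :
    ∃ y, ∀ n ≥ k, ∀ c ∈ S (n + 1), dist (p (n + 1) c) y ≤ (1 / 2 : ℝ) ^ n := by
  have hback : ∀ n ≥ k, ∀ m, ∀ c ∈ S (n + m), ∃ c' ∈ S n, p (n + m) c = p n c' := by
    intro n hn m
    induction m with
    | zero => exact fun c hc => ⟨c, hc, rfl⟩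
    | succ m ih =>
      intro c hc
      have hc' := hS (n + m) hc
      rcases hred (n + m) (by omega) c with h | h
      · obtain ⟨c', h1, h2⟩ := ih _ hc'.1
        exact ⟨c', h1, h.trans h2⟩
      · obtain ⟨c', h1, h2⟩ := ih _ hc'.2.1
        exact ⟨c', h1, h.trans h2⟩
  choose s hs using hne
  have hclose : ∀ n ≥ k, ∀ m ≥ n + 1, ∀ c ∈ S (n + 1),
      dist (p (n + 1) c) (p m (s m)) ≤ (1 / 2 : ℝ) ^ n := by
    intro n hn m hm c hc
    obtain ⟨j, rfl⟩ := Nat.exists_eq_add_of_le hm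
    obtain ⟨c', h1, h2⟩ := hback (n + 1) (by omega) j _ (hs _)
    rw [h2]
    exact (hp _ _ _).trans (hd _ _ hc _ h1)
  have hcauchy : CauchySeq fun n => p n (s n) := by
    rw [Metric.cauchySeq_iff']
    intro ε hε
    obtain ⟨n, hn⟩ := exists_pow_lt_of_lt_one hε (show (1 / 2 : ℝ) < 1 by norm_num)
    refine ⟨max n k + 1, fun m hm => ?_⟩
    rw [dist_comm]
    refine (hclose (max n k) (le_max_right _ _) m hm _ (hs _)).trans_lt (lt_of_le_of_lt ?_ hn)
    exact pow_le_pow_of_le_one (by norm_num) (by norm_num) (le_max_left _ _)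
  obtain ⟨y, hy⟩ := cauchySeq_tendsto_of_complete hcauchy
  refine ⟨y, fun n hn c hc => ?_⟩
  refine le_of_tendsto (tendsto_const_nhds.dist hy) ?_
  filter_upwards [eventually_ge_atTop (n + 1)] with m hm
  exact hclose n hn m hm c hc

variable [MeasurableSpace X] [BorelSpace X] [CompleteSpace X] [CompleteSpace W]
  [SecondCountableTopology X] [SecondCountableTopology W]

/-- The induction hypothesis in the construction of the sets of configurations. -/
structure Splittable (E : X → X → Prop) (g : ℕ → W → X × X) (a b : ℕ → ℕ → Bool) (n : ℕ)
    (S : Set (Config X W n)) : Prop where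
  measurableSet : MeasurableSet S
  large : Large E (split (g n) (a n) (b n) S)
  nontrivial : n ≠ 0 → ∀ c ∈ S, ∃ x ∈ pts n c, ∃ y ∈ pts n c, ¬ E x y

lemma Splittable.exists_succ (hE : Equivalence E) (hB : MeasurableSet {p : X × X | E p.1 p.2})
    (hg : ∀ n, Continuous (g n)) (hg0 : ∀ n, Even n → range (g n) = {p : X × X | ¬ E p.1 p.2})
    (hg1 : ∀ n, ¬ Even n → range (g n) = {p : X × X | E p.1 p.2})
    (hab : ∀ n, Even n → a n = b n) {n : ℕ} {S : Set (Config X W n)}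
    (h : Splittable E g a b n S) :
    ∃ S' : Set (Config X W (n + 1)), Splittable E g a b (n + 1) S' ∧
      S' ⊆ split (g n) (a n) (b n) S ∧ ∀ c ∈ S', ∀ c' ∈ S', dist c c' ≤ (1 / 2 : ℝ) ^ n := by
  have hne : Nonempty (Config X W (n + 1)) := by
    obtain ⟨c, -, -⟩ := h.large ∅ ⟨countable_empty, by simp, by simp⟩
    exact ⟨c⟩
  have hpos : (0 : ℝ) < (1 / 2) ^ n / 2 := by positivity
  obtain ⟨i, hi⟩ := h.large.exists_of_subset_iUnion
    (T := fun i => Metric.ball (TopologicalSpace.denseSeq (Config X W (n + 1)) i) ((1 / 2) ^ n / 2))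
    (fun c _ => by
      obtain ⟨_, hi, ⟨i, rfl⟩⟩ := Metric.dense_iff.1
        (TopologicalSpace.denseRange_denseSeq (Config X W (n + 1))) c _ hpos
      exact mem_iUnion.2 ⟨i, Metric.mem_ball_comm.1 hi⟩)
  set B := Metric.ball (TopologicalSpace.denseSeq (Config X W (n + 1)) i) ((1 / 2) ^ n / 2)
  have hm : MeasurableSet (split (g n) (a n) (b n) S ∩ B) :=
    (measurableSet_split (hg n) _ _ h.measurableSet).inter Metric.isOpen_ball.measurableSet
  have hnt : ∀ c ∈ split (g n) (a n) (b n) S ∩ B,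
      ∃ x ∈ pts (n + 1) c, ∃ y ∈ pts (n + 1) c, ¬ E x y := by
    rintro c ⟨⟨hc, hc', hw⟩, -⟩
    by_cases hn : Even n
    · refine ⟨_, Or.inl (pt_mem_pts n c.1 (a n)), _, Or.inr (pt_mem_pts n c.2.1 (b n)), ?_⟩
      have : (pt n c.1 (a n), pt n c.2.1 (b n)) ∈ range (g n) := ⟨_, hw⟩
      rwa [hg0 n hn] at this
    · obtain ⟨x, hx, y, hy, hxy⟩ := h.nontrivial (by rintro rfl; simp at hn) _ hc
      exact ⟨x, Or.inl hx, y, Or.inl hy, hxy⟩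
  refine ⟨split (g n) (a n) (b n) S ∩ B, ⟨hm, ?_, fun _ => hnt⟩, inter_subset_left,
    fun c hc c' hc' => ?_⟩
  · by_cases hn : Even (n + 1)
    · rw [← hab _ hn]
      exact hi.split_of_not_rel hE hB (hg0 _ hn) hm hnt _
    · exact hi.split_of_rel hE hB (hg1 _ hn) hm _ _
  · have h1 := Metric.mem_ball.1 hc.2
    have h2 := Metric.mem_ball'.1 hc'.2
    linarith [dist_triangle c (TopologicalSpace.denseSeq (Config X W (n + 1)) i) c']

lemma exists_fusion_sequence (hE : Equivalence E) (hB : MeasurableSet {p : X × X | E p.1 p.2})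
    (hg : ∀ n, Continuous (g n)) (hg0 : ∀ n, Even n → range (g n) = {p : X × X | ¬ E p.1 p.2})
    (hg1 : ∀ n, ¬ Even n → range (g n) = {p : X × X | E p.1 p.2})
    (hab : ∀ n, Even n → a n = b n)
    (hns : ∀ 𝒞, IsInvariantFamily E 𝒞 → ∃ x y, Indist 𝒞 x y ∧ ¬ E x y) :
    ∃ S : ∀ n, Set (Config X W n), (∀ n, (S n).Nonempty) ∧
      (∀ n, S (n + 1) ⊆ split (g n) (a n) (b n) (S n)) ∧
      ∀ n, ∀ c ∈ S (n + 1), ∀ c' ∈ S (n + 1), dist c c' ≤ (1 / 2 : ℝ) ^ n := by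
  have h0 : Splittable E g a b 0 univ := by
    refine ⟨.univ, fun 𝒞 h𝒞 => ?_, fun h => absurd rfl h⟩
    obtain ⟨x, y, hxy, hn⟩ := hns 𝒞 h𝒞
    obtain ⟨w, hw⟩ : (x, y) ∈ range (g 0) := by rw [hg0 0 (by simp)]; exact hn
    refine ⟨(x, y, w), ⟨mem_univ _, mem_univ _, hw⟩, ?_⟩
    have hs : ∀ x : X, Compat (W := W) 𝒞 0 x := by
      intro x A _
      exact (em (x ∈ A)).imp singleton_subset_iff.2 singleton_subset_iff.2
    exact (hs x).join (hs y) (mem_singleton x) (mem_singleton y) hxy w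
  have hstep := fun n (S : Set (Config X W n)) (h : Splittable E g a b n S) =>
    h.exists_succ hE hB hg hg0 hg1 hab
  choose next h1 h2 h3 using hstep
  let F : ∀ n, {S : Set (Config X W n) // Splittable E g a b n S} := fun n =>
    Nat.rec ⟨univ, h0⟩ (fun n S => ⟨next n S.1 S.2, h1 n S.1 S.2⟩) n
  refine ⟨fun n => (F n).1, fun n => ?_, fun n => h2 n _ (F n).2, fun n => h3 n _ (F n).2⟩
  obtain ⟨c, hc, -⟩ := (F n).2.large ∅ ⟨countable_empty, by simp, by simp⟩
  exact ⟨c.1, hc.1⟩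

/-- If no countable family of invariant Borel sets determines `E`, there is a continuous map from
Cantor space sending the edges of even level outside of `E` and those of odd level into `E`. -/
lemma exists_homomorphism [Inhabited W] (hE : Equivalence E)
    (hB : MeasurableSet {p : X × X | E p.1 p.2})
    (hg : ∀ n, Continuous (g n)) (hg0 : ∀ n, Even n → range (g n) = {p : X × X | ¬ E p.1 p.2})
    (hg1 : ∀ n, ¬ Even n → range (g n) = {p : X × X | E p.1 p.2})
    (hab : ∀ n, Even n → a n = b n)
    (hns : ∀ 𝒞, IsInvariantFamily E 𝒞 → ∃ x y, Indist 𝒞 x y ∧ ¬ E x y) :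
    ∃ f : (ℕ → Bool) → X, Continuous f ∧ ∀ k x y, (∀ i < k, x i = a k i) → x k = false →
      (∀ i < k, y i = b k i) → y k = true → (∀ i > k, x i = y i) → (E (f x) (f y) ↔ ¬ Even k) := by
  obtain ⟨S, hne, hS, hd⟩ := exists_fusion_sequence hE hB hg hg0 hg1 hab hns
  have hlim := fun z => exists_limit_of_scheme hne hS hd (fun n c => pt n c z)
    (fun n c c' => dist_pt_le z n c c') 0 (fun n _ c => by
      simp only [pt]
      split_ifs <;> simp)
  choose f hf using hlim
  choose s hs using hne
  have hft : ∀ z, Tendsto (fun n => pt (n + 1) (s (n + 1)) z) atTop (𝓝 (f z)) := fun z => by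
    rw [tendsto_iff_dist_tendsto_zero]
    exact squeeze_zero (fun _ => dist_nonneg) (fun n => hf z n (Nat.zero_le n) _ (hs _))
      (tendsto_pow_atTop_nhds_zero_of_lt_one (by norm_num) (by norm_num))
  refine ⟨f, ?_, fun k x y hx hxk hy hyk hxy => ?_⟩
  · have hu : TendstoUniformly (fun n z => pt (n + 1) (s (n + 1)) z) f atTop := by
      rw [Metric.tendstoUniformly_iff]
      intro ε hε
      filter_upwards [(tendsto_pow_atTop_nhds_zero_of_lt_one (r := (1 / 2 : ℝ)) (by norm_num)
        (by norm_num)).eventually (gt_mem_nhds hε)] with n hn z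
      rw [dist_comm]
      exact (hf z n (Nat.zero_le n) _ (hs _)).trans_lt hn
    refine hu.continuous (Frequently.of_forall fun n => ?_)
    refine continuous_iff_continuousAt.2 fun z => ?_
    refine (continuousAt_const (y := pt (n + 1) (s (n + 1)) z)).congr ?_
    filter_upwards [(PiNat.isOpen_cylinder (fun _ => Bool) z (n + 1)).mem_nhds
      (PiNat.self_mem_cylinder z (n + 1))] with z' hz'
    exact pt_congr _ _ fun i hi => (PiNat.mem_cylinder_iff.1 hz' i hi).symm
  · obtain ⟨w, hw⟩ := exists_limit_of_scheme (fun n => ⟨_, hs n⟩) hS hd (fun n c => wit n c k y)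
      (fun n c c' => dist_wit_le k y n c c') (k + 1) (fun n hn c => by
        simp only [wit]
        rw [if_neg (by omega)]
        split_ifs <;> simp)
    have hwt : Tendsto (fun n => wit (n + 1) (s (n + 1)) k y) atTop (𝓝 w) := by
      rw [tendsto_iff_dist_tendsto_zero]
      refine squeeze_zero' (.of_forall fun _ => dist_nonneg) ?_
        (tendsto_pow_atTop_nhds_zero_of_lt_one (r := (1 / 2 : ℝ)) (by norm_num) (by norm_num))
      filter_upwards [eventually_ge_atTop (k + 1)] with n hn
      exact hw n hn _ (hs _)
    have hedge : ∀ n ≥ k, ∀ c ∈ S (n + 1),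
        g k (wit (n + 1) c k y) = (pt (n + 1) c x, pt (n + 1) c y) := by
      intro n hn
      induction n, hn using Nat.le_induction with
      | base =>
        intro c hc
        simp only [wit, pt, hxk, hyk, if_true, Bool.false_eq_true, if_false]
        rw [(hS k hc).2.2, pt_congr k _ hx, pt_congr k _ hy]
      | succ n hn ih =>
        intro c hc
        have hc' := hS (n + 1) hc
        rw [wit, pt_succ (n + 1), pt_succ (n + 1), if_neg (by omega), hxy (n + 1) (by omega)]
        split_ifs
        exacts [ih _ hc'.2.1, ih _ hc'.1]
    have heq : g k w = (f x, f y) := by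
      refine tendsto_nhds_unique (((hg k).tendsto w).comp hwt) ?_
      refine ((hft x).prodMk_nhds (hft y)).congr' ?_
      filter_upwards [eventually_ge_atTop k] with n hn
      exact (hedge n hn _ (hs _)).symm
    have hmem : (f x, f y) ∈ range (g k) := ⟨w, heq⟩
    by_cases hk : Even k
    · rw [hg0 k hk] at hmem
      exact iff_of_false hmem (not_not.2 hk)
    · rw [hg1 k hk] at hmem
      exact iff_of_true hmem hk

end Fusion

section Cantor

/-- The sequence following `u` below `ℓ` and `v` from `ℓ` on. -/
def splice (ℓ : ℕ) (u v : ℕ → Bool) : ℕ → Bool := fun i => if i < ℓ then u i else v i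

/-- Density of the pairs of prefixes of `a k` and `b k` of length `k`, for even `k` on the diagonal
and for odd `k` in the plane. -/
structure DensePrefixes (a b : ℕ → ℕ → Bool) : Prop where
  eq_of_even : ∀ k, Even k → a k = b k
  exists_even : ∀ (x : ℕ → Bool) m, ∃ k ≥ m, Even k ∧ ∀ i < m, a k i = x i
  exists_odd : ∀ (x y : ℕ → Bool) m, ∃ k ≥ m, ¬ Even k ∧ ∀ i < m, a k i = x i ∧ b k i = y i

lemma exists_densePrefixes : ∃ a b, DensePrefixes a b := by
  obtain ⟨e, he⟩ := exists_surjective_nat (List Bool × List Bool)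
  let q : ℕ → List Bool × List Bool := fun k => e (k / 2).unpair.1
  have hlist : ∀ (x : ℕ → Bool) m i, i < m → ((List.range m).map x).getD i false = x i := by
    intro x m i hi
    simp [List.getD, hi]
  refine ⟨fun k i => (q k).1.getD i false,
    fun k i => if Even k then (q k).1.getD i false else (q k).2.getD i false,
    fun k hk => by simp [hk], fun x m => ?_, fun x y m => ?_⟩
  · obtain ⟨j, hj⟩ := he ((List.range m).map x, [])
    have hm := Nat.right_le_pair j m
    refine ⟨2 * Nat.pair j m, by omega, by simp, fun i hi => ?_⟩
    simp only [q, Nat.mul_div_cancel_left _ two_pos, Nat.unpair_pair, hj]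
    exact hlist x m i hi
  · obtain ⟨j, hj⟩ := he ((List.range m).map x, (List.range m).map y)
    have hm := Nat.right_le_pair j m
    have hodd : ¬ Even (2 * Nat.pair j m + 1) := by simp
    refine ⟨2 * Nat.pair j m + 1, by omega, hodd, fun i hi => ?_⟩
    have hdiv : (2 * Nat.pair j m + 1) / 2 = Nat.pair j m := by omega
    simp only [q, if_neg hodd, hdiv, Nat.unpair_pair, hj]
    exact ⟨hlist x m i hi, hlist y m i hi⟩

/-- Neighbourhoods in the square of Cantor space contain boxes given by prefixes. -/
lemma exists_prefix_of_isOpen {U : Set ((ℕ → Bool) × (ℕ → Bool))} (hU : IsOpen U)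
    {x y : ℕ → Bool} (h : (x, y) ∈ U) (m : ℕ) :
    ∃ n ≥ m, ∀ x' y', (∀ i < n, x' i = x i) → (∀ i < n, y' i = y i) → (x', y') ∈ U := by
  obtain ⟨V, V', hV, hV', hx, hy, hsub⟩ := isOpen_prod_iff.1 hU x y h
  have key : ∀ {V : Set (ℕ → Bool)}, IsOpen V → ∀ {x}, x ∈ V →
      ∃ n, ∀ x' : ℕ → Bool, (∀ i < n, x' i = x i) → x' ∈ V := by
    intro V hV x hx
    obtain ⟨_, ⟨z, n, rfl⟩, hxz, hzV⟩ :=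
      (PiNat.isTopologicalBasis_cylinders fun _ => Bool).exists_subset_of_mem_open hx hV
    exact ⟨n, fun x' hx' => hzV (PiNat.mem_cylinder_iff.2 fun i hi =>
      (hx' i hi).trans (PiNat.mem_cylinder_iff.1 hxz i hi))⟩
  obtain ⟨n1, h1⟩ := key hV hx
  obtain ⟨n2, h2⟩ := key hV' hy
  refine ⟨max m (max n1 n2), le_max_left _ _, fun x' y' hx' hy' => hsub ⟨?_, ?_⟩⟩
  · exact h1 x' fun i hi => hx' i (by omega)
  · exact h2 y' fun i hi => hy' i (by omega)

lemma isOpen_setOf_prefix (n : ℕ) (x y : ℕ → Bool) :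
    IsOpen {p : (ℕ → Bool) × (ℕ → Bool) | (∀ i < n, p.1 i = x i) ∧ ∀ i < n, p.2 i = y i} := by
  have : {p : (ℕ → Bool) × (ℕ → Bool) | (∀ i < n, p.1 i = x i) ∧ ∀ i < n, p.2 i = y i} =
      PiNat.cylinder (E := fun _ => Bool) x n ×ˢ PiNat.cylinder (E := fun _ => Bool) y n := by
    ext p; simp [PiNat.mem_cylinder_iff]
  rw [this]
  exact (PiNat.isOpen_cylinder (fun _ => Bool) x n).prod
    (PiNat.isOpen_cylinder (fun _ => Bool) y n)

variable {F : (ℕ → Bool) → (ℕ → Bool) → Prop} {a b : ℕ → ℕ → Bool}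

/-- Negation of the `k`-th digit. -/
def flip (k : ℕ) (x : ℕ → Bool) : ℕ → Bool := Function.update x k (!x k)

lemma flip_flip (k : ℕ) (x : ℕ → Bool) : flip k (flip k x) = x := by simp [flip]

lemma continuous_flip (k : ℕ) : Continuous (flip k) := by
  refine continuous_id.update k ?_
  exact (continuous_of_discreteTopology (f := not)).comp (continuous_apply (A := fun _ => Bool) k)

/-- An equivalence relation avoiding the even edges is meager. -/
lemma compl_mem_residual (hF : Equivalence F)
    (hm : MeasurableSet {p : (ℕ → Bool) × (ℕ → Bool) | F p.1 p.2}) (hab : DensePrefixes a b)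
    (hedge : ∀ k x y, (∀ i < k, x i = a k i) → x k = false →
      (∀ i < k, y i = b k i) → y k = true → (∀ i > k, x i = y i) → (F x y ↔ ¬ Even k)) :
    {p : (ℕ → Bool) × (ℕ → Bool) | ¬ F p.1 p.2} ∈ residual _ := by
  obtain ⟨U, hU, hFU⟩ := hm.residualEq_isOpen
  have hFU' : ∀ᶠ p in residual ((ℕ → Bool) × (ℕ → Bool)), F p.1 p.2 ↔ p ∈ U :=
    eventuallyEq_set.1 hFU
  suffices U = ∅ by
    filter_upwards [hFU'] with p hp
    simp [hp, this]
  by_contra hne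
  obtain ⟨⟨x0, y0⟩, hxy⟩ := nonempty_iff_ne_empty.2 hne
  obtain ⟨m, -, hmU⟩ := exists_prefix_of_isOpen hU hxy 0
  obtain ⟨k, hkm, hk, hak⟩ := hab.exists_even x0 m
  let h : ((ℕ → Bool) × (ℕ → Bool)) ≃ₜ ((ℕ → Bool) × (ℕ → Bool)) :=
    Homeomorph.prodCongr
      { toFun := flip k
        invFun := flip k
        left_inv := flip_flip k
        right_inv := flip_flip k
        continuous_toFun := continuous_flip k
        continuous_invFun := continuous_flip k } (Homeomorph.refl _)
  have hflip := (tendsto_residual_of_isOpenMap h.continuous h.isOpenMap).eventually hFU'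
  obtain ⟨⟨x, y⟩, ⟨hx, hy⟩, h1, h2⟩ := (dense_of_mem_residual (hFU'.and hflip)).inter_open_nonempty _
    (isOpen_setOf_prefix (k + 1) (Function.update (a k) k false) y0)
    ⟨(Function.update (a k) k false, y0), by simp⟩
  replace hx : ∀ i < k + 1, x i = Function.update (a k) k false i := hx
  have hxa : ∀ i < k, x i = a k i := fun i hi => by
    rw [hx i (by omega), Function.update_of_ne (by omega)]
  have hxk : x k = false := by simp [hx k (by omega)]
  have e1 : F x y := h1.2 (hmU _ _ (fun i hi => (hxa i (by omega)).trans (hak i hi))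
    fun i hi => hy i (by omega))
  have e2 : F (flip k x) y := h2.2 (hmU _ _ (fun i hi => by
    change flip k x i = x0 i
    rw [flip, Function.update_of_ne (by omega), hxa i (by omega), hak i hi])
    fun i hi => hy i (by omega))
  refine (hedge k x (flip k x) hxa hxk (fun i hi => ?_) ?_ fun i hi => ?_).1
    (hF.trans e1 (hF.symm e2)) hk
  · rw [flip, Function.update_of_ne (by omega), hxa i hi, hab.eq_of_even k hk]
  · simp [flip, hxk]
  · rw [flip, Function.update_of_ne (by omega)]

/-- Every dense open set contains all pairs with suitable digits in some block. -/
lemma exists_block {D : Set ((ℕ → Bool) × (ℕ → Bool))} (hD : IsOpen D) (hd : Dense D) (ℓ : ℕ) :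
    ∃ ℓ' ≥ ℓ, ∃ p q : ℕ → Bool, ∀ x y : ℕ → Bool,
      (∀ i, ℓ ≤ i → i < ℓ' → x i = p i ∧ y i = q i) → (x, y) ∈ D := by
  have hfin : ∀ Q : Finset ((ℕ → Bool) × (ℕ → Bool)), ∃ ℓ' ≥ ℓ, ∃ p q : ℕ → Bool,
      ∀ r ∈ Q, ∀ x y : ℕ → Bool, (∀ i < ℓ, x i = r.1 i ∧ y i = r.2 i) →
      (∀ i, ℓ ≤ i → i < ℓ' → x i = p i ∧ y i = q i) → (x, y) ∈ D := by
    classical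
    intro Q
    induction Q using Finset.induction_on with
    | empty => exact ⟨ℓ, le_rfl, fun _ => false, fun _ => false, by simp⟩
    | insert r Q hr ih =>
      obtain ⟨n, hn, p, q, ih⟩ := ih
      obtain ⟨⟨x0, y0⟩, ⟨hx0, hy0⟩, h0⟩ := hd.inter_open_nonempty _
        (isOpen_setOf_prefix n (splice ℓ r.1 p) (splice ℓ r.2 q))
        ⟨(splice ℓ r.1 p, splice ℓ r.2 q), by simp⟩
      obtain ⟨n', hn', h'⟩ := exists_prefix_of_isOpen hD h0 n
      simp only [splice] at hx0 hy0
      refine ⟨n', by omega, x0, y0, fun s hs x y h1 h2 => ?_⟩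
      rcases Finset.mem_insert.1 hs with rfl | hs
      · refine h' x y (fun i hi => ?_) (fun i hi => ?_) <;> by_cases hil : i < ℓ
        · rw [(h1 i hil).1, hx0 i (by omega), if_pos hil]
        · exact (h2 i (by omega) hi).1
        · rw [(h1 i hil).2, hy0 i (by omega), if_pos hil]
        · exact (h2 i (by omega) hi).2
      · refine ih s hs x y h1 fun i hi hin => ?_
        rw [(h2 i hi (by omega)).1, (h2 i hi (by omega)).2, hx0 i hin, hy0 i hin,
          if_neg (by omega), if_neg (by omega)]
        exact ⟨rfl, rfl⟩
  classical
  let ext : (Fin ℓ → Bool) → ℕ → Bool := fun u i => if h : i < ℓ then u ⟨i, h⟩ else false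
  obtain ⟨ℓ', hℓ, p, q, h⟩ := hfin
    (Finset.univ.image fun u : (Fin ℓ → Bool) × (Fin ℓ → Bool) => (ext u.1, ext u.2))
  refine ⟨ℓ', hℓ, p, q, fun x y hxy => h (ext fun i => x i, ext fun i => y i) ?_ x y ?_ hxy⟩
  · exact Finset.mem_image.2 ⟨(fun i => x i, fun i => y i), Finset.mem_univ _, rfl⟩
  · intro i hi
    simp [ext, hi]

lemma exists_linked_block {D : Set ((ℕ → Bool) × (ℕ → Bool))} (hD : IsOpen D) (hd : Dense D)
    (hab : DensePrefixes a b)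
    (hedge : ∀ k x y, (∀ i < k, x i = a k i) → x k = false →
      (∀ i < k, y i = b k i) → y k = true → (∀ i > k, x i = y i) → (F x y ↔ ¬ Even k))
    (ℓ : ℕ) (t : ℕ → Bool) :
    ∃ ℓ' > ℓ, ∃ p q : ℕ → Bool,
      (∀ x y : ℕ → Bool, (∀ i, ℓ ≤ i → i < ℓ' → x i = p i ∧ y i = q i) → (x, y) ∈ D) ∧
      ∀ z, F (splice ℓ t (splice ℓ' p z)) (splice ℓ t (splice ℓ' q z)) := by
  obtain ⟨m, hm, p, q, hpq⟩ := exists_block hD hd ℓ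
  obtain ⟨k, hkm, hk, hak⟩ := hab.exists_odd (splice ℓ t p) (splice ℓ t q) m
  simp only [splice] at hak
  refine ⟨k + 1, by omega, Function.update (a k) k false, Function.update (b k) k true,
    fun x y hxy => hpq x y fun i hi him => ?_, fun z => ?_⟩
  · have := hxy i hi (by omega)
    rw [Function.update_of_ne (by omega), Function.update_of_ne (by omega), (hak i him).1,
      (hak i him).2, if_neg (by omega), if_neg (by omega)] at this
    exact this
  · refine (hedge k _ _ (fun i hi => ?_) ?_ (fun i hi => ?_) ?_ fun i hi => ?_).2 hk
    · by_cases hil : i < ℓ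
      · simp [splice, hil, (hak i (by omega)).1]
      · simp [splice, hil, show i < k + 1 by omega, hi.ne]
    · simp [splice, show ¬ k < ℓ by omega]
    · by_cases hil : i < ℓ
      · simp [splice, hil, (hak i (by omega)).2]
      · simp [splice, hil, show i < k + 1 by omega, hi.ne]
    · simp [splice, show ¬ k < ℓ by omega]
    · simp [splice, show ¬ i < ℓ by omega, show ¬ i < k + 1 by omega]

/-- Given a sequence of dense open sets, there is a continuous map sending `E₀`-related points to
`F`-related ones such that the images of points differing at digit `n` (in the
right order) form a pair in the `n`-th open set. -/
lemma exists_continuous_of_dense (hF : Equivalence F) (hab : DensePrefixes a b)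
    (hedge : ∀ k x y, (∀ i < k, x i = a k i) → x k = false →
      (∀ i < k, y i = b k i) → y k = true → (∀ i > k, x i = y i) → (F x y ↔ ¬ Even k))
    {D : ℕ → Set ((ℕ → Bool) × (ℕ → Bool))} (hD : ∀ n, IsOpen (D n)) (hd : ∀ n, Dense (D n)) :
    ∃ ψ : (ℕ → Bool) → (ℕ → Bool), Continuous ψ ∧ (∀ x y, E0 x y → F (ψ x) (ψ y)) ∧
      ∀ x y n, x n = false → y n = true → (ψ x, ψ y) ∈ D n := by
  have hstep := fun n => exists_linked_block (hD n) (hd n) hab hedge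
  choose L hL p q hpq hlink using hstep
  let st : ℕ → ℕ × (ℕ → Bool) := fun n =>
    Nat.rec (0, fun _ => false) (fun n s => (L n s.1 s.2, splice s.1 s.2 (p n s.1 s.2))) n
  let ℓ : ℕ → ℕ := fun n => (st n).1
  let t : ℕ → ℕ → Bool := fun n => (st n).2
  let r : ℕ → Bool → ℕ → Bool := fun n c => if c then q n (ℓ n) (t n) else p n (ℓ n) (t n)
  have hℓ : StrictMono ℓ := strictMono_nat_of_lt_succ fun n => hL n _ _
  have ht : ∀ n, t (n + 1) = splice (ℓ n) (t n) (p n (ℓ n) (t n)) := fun n => rfl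
  have hblk : ∀ i, ∃ n, ℓ n ≤ i ∧ i < ℓ (n + 1) := by
    intro i
    classical
    have hex : ∃ n, i < ℓ (n + 1) := ⟨i, hℓ.le_apply.trans_lt' (Nat.lt_succ_self i)⟩
    refine ⟨Nat.find hex, ?_, Nat.find_spec hex⟩
    rcases h : Nat.find hex with _ | m
    · exact Nat.zero_le i
    · exact not_lt.1 (Nat.find_min hex (h ▸ Nat.lt_succ_self m))
  choose blk hblk1 hblk2 using hblk
  have hblk_eq : ∀ n i, ℓ n ≤ i → i < ℓ (n + 1) → blk i = n := by
    intro n i h1 h2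
    have h3 : ℓ (blk i) < ℓ (n + 1) := (hblk1 i).trans_lt h2
    have h4 : ℓ n < ℓ (blk i + 1) := h1.trans_lt (hblk2 i)
    have h5 : blk i < n + 1 := not_le.1 fun h => h3.not_ge (hℓ.monotone h)
    have h6 : n < blk i + 1 := not_le.1 fun h => h4.not_ge (hℓ.monotone h)
    omega
  let ψ : (ℕ → Bool) → (ℕ → Bool) := fun w i => r (blk i) (w (blk i)) i
  have hψ : ∀ w n i, ℓ n ≤ i → i < ℓ (n + 1) → ψ w i = r n (w n) i := by
    intro w n i h1 h2
    simp only [ψ, hblk_eq n i h1 h2]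
  have hbase : ∀ n w z, F (splice (ℓ n) (ψ w) z) (splice (ℓ n) (t n) z) := by
    intro n
    induction n with
    | zero =>
      intro w z
      have : ∀ u, splice (ℓ 0) u z = z := fun u => funext fun i => if_neg (Nat.not_lt_zero i)
      rw [this, this]
      exact hF.refl z
    | succ n ih =>
      intro w z
      have h1 : splice (ℓ (n + 1)) (ψ w) z =
          splice (ℓ n) (ψ w) (splice (ℓ (n + 1)) (r n (w n)) z) := by
        funext i
        simp only [splice]
        have : ℓ n < ℓ (n + 1) := hℓ (Nat.lt_succ_self n)
        split_ifs with h1 h2 h2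
        · rfl
        · exact hψ w n i (not_lt.1 h2) h1
        · omega
        · rfl
      have h2 : splice (ℓ (n + 1)) (t (n + 1)) z =
          splice (ℓ n) (t n) (splice (ℓ (n + 1)) (p n (ℓ n) (t n)) z) := by
        funext i
        rw [ht]
        simp only [splice]
        have : ℓ n < ℓ (n + 1) := hℓ (Nat.lt_succ_self n)
        split_ifs <;> first | rfl | omega
      rw [h1, h2]
      refine hF.trans (ih w _) ?_
      rcases hw : w n with _ | _
      · exact hF.refl _
      · exact hF.symm (hlink n (ℓ n) (t n) z)
  refine ⟨ψ, ?_, fun x y hxy => ?_, fun x y n hx hy => ?_⟩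
  · refine continuous_pi fun i => ?_
    exact (continuous_of_discreteTopology (f := fun c => r (blk i) c i)).comp
      (continuous_apply (blk i))
  · obtain ⟨n, hn⟩ := hxy.bddAbove
    have hn : ∀ i, n < i → x i = y i := fun i hi => by
      by_contra hne
      exact absurd (hn hne) (not_le.2 hi)
    have self : ∀ m u, splice m u u = u := fun m u => funext fun i => by simp [splice]
    have heq : splice (ℓ (n + 1)) (t (n + 1)) (ψ x) = splice (ℓ (n + 1)) (t (n + 1)) (ψ y) := by
      funext i
      simp only [splice]
      split_ifs with h
      · rfl
      · have h1 : ℓ (n + 1) < ℓ (blk i + 1) := (not_lt.1 h).trans_lt (hblk2 i)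
        have h2 : n + 1 < blk i + 1 := not_le.1 fun h => h1.not_ge (hℓ.monotone h)
        simp only [ψ, hn (blk i) (by omega)]
    have hx := hbase (n + 1) x (ψ x)
    have hy := hbase (n + 1) y (ψ y)
    rw [self] at hx hy
    rw [heq] at hx
    exact hF.trans hx (hF.symm hy)
  · refine hpq n (ℓ n) (t n) _ _ fun i h1 h2 => ⟨?_, ?_⟩
    · rw [hψ x n i h1 h2, hx]; rfl
    · rw [hψ y n i h1 h2, hy]; rfl

end Cantor

/-- An equivalence relation determined by a countable family of Borel sets is smooth. -/
lemma exists_measurable_reduction {X : Type*} [MeasurableSpace X] {E : X → X → Prop}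
    {𝒞 : Set (Set X)} (h𝒞 : IsInvariantFamily E 𝒞) (h : ∀ x y, Indist 𝒞 x y → E x y) :
    ∃ θ : X → (ℕ → Bool), Measurable θ ∧ ∀ x y, E x y ↔ θ x = θ y := by
  classical
  have h' : IsInvariantFamily E (insert univ 𝒞) := h𝒞.insert .univ fun _ _ _ => Iff.rfl
  obtain ⟨c, hc⟩ := h'.countable.exists_eq_range (insert_nonempty _ _)
  have hmem : ∀ n, c n ∈ insert univ 𝒞 := fun n => hc ▸ mem_range_self n
  refine ⟨fun x n => decide (x ∈ c n), measurable_pi_iff.2 fun n => ?_, fun x y =>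
    ⟨fun hxy => funext fun n => ?_, fun hxy => h x y fun A hA => ?_⟩⟩
  · refine measurable_to_bool ?_
    convert h'.measurableSet _ (hmem n) using 1
    ext x; simp
  · exact decide_eq_decide.2 (h'.invariant _ (hmem n) x y hxy)
  · obtain ⟨n, rfl⟩ : A ∈ range c := hc ▸ mem_insert_of_mem _ hA
    exact decide_eq_decide.1 (congrFun hxy n)

/-- A continuous map sending the even edges outside of `E` and the odd ones into `E` can be
composed with a self-map of Cantor space to give an embedding of `E₀` into `E`. -/
lemma exists_embedding_of_homomorphism {X : Type*} [TopologicalSpace X] [PolishSpace X]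
    [MeasurableSpace X] [BorelSpace X] {E : X → X → Prop} (hE : Equivalence E)
    (hB : MeasurableSet {p : X × X | E p.1 p.2}) {a b : ℕ → ℕ → Bool} (hab : DensePrefixes a b)
    {φ : (ℕ → Bool) → X} (hφ : Continuous φ)
    (hedge : ∀ k x y, (∀ i < k, x i = a k i) → x k = false →
      (∀ i < k, y i = b k i) → y k = true → (∀ i > k, x i = y i) → (E (φ x) (φ y) ↔ ¬ Even k)) :
    ∃ f : (ℕ → Bool) → X, Continuous f ∧ Function.Injective f ∧
      ∀ x y, E0 x y ↔ E (f x) (f y) := by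
  have hF : Equivalence fun x y => E (φ x) (φ y) :=
    ⟨fun x => hE.refl _, fun h => hE.symm h, fun h h' => hE.trans h h'⟩
  have hm : MeasurableSet {p : (ℕ → Bool) × (ℕ → Bool) | E (φ p.1) (φ p.2)} := by
    have := hφ.measurable
    exact (show Measurable fun p : (ℕ → Bool) × (ℕ → Bool) => (φ p.1, φ p.2) by fun_prop) hB
  have hres := compl_mem_residual hF hm hab hedge
  obtain ⟨T, hTo, hTd, hTc, hT⟩ := mem_residual_iff.1 hres
  obtain ⟨O, hO⟩ := (hTc.insert univ).exists_eq_range (insert_nonempty _ _)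
  have hOmem : ∀ n, O n ∈ insert univ T := fun n => hO ▸ mem_range_self n
  have hOo : ∀ n, IsOpen (O n) := fun n => by
    rcases hOmem n with h | h
    exacts [h ▸ isOpen_univ, hTo _ h]
  have hOd : ∀ n, Dense (O n) := fun n => by
    rcases hOmem n with h | h
    exacts [h ▸ dense_univ, hTd _ h]
  let N : Set ((ℕ → Bool) × (ℕ → Bool)) := {p | φ p.1 ≠ φ p.2}
  have hNo : IsOpen N := (isClosed_eq hφ.fst' hφ.snd').isOpen_compl
  have hNd : Dense N := (dense_of_mem_residual hres).mono
    (show {p | ¬ E (φ p.1) (φ p.2)} ⊆ N from fun p hp heq => hp (by rw [heq]; exact hE.refl _))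
  let D : ℕ → Set ((ℕ → Bool) × (ℕ → Bool)) := fun n => N ∩ ⋂ i ∈ Finset.range (n + 1), O i
  have hD : ∀ n, IsOpen (D n) := fun n =>
    hNo.inter (isOpen_biInter_finset fun i _ => hOo i)
  have hDd : ∀ n, Dense (D n) := fun n => by
    refine dense_of_mem_residual (inter_mem (residual_of_dense_open hNo hNd) ?_)
    exact (biInter_finset_mem _).2 fun i _ => residual_of_dense_open (hOo i) (hOd i)
  obtain ⟨ψ, hψ, hψE, hψD⟩ := exists_continuous_of_dense hF hab hedge hD hDd
  have hnot : ∀ x y, {n | x n = false ∧ y n = true}.Infinite → ¬ E (φ (ψ x)) (φ (ψ y)) := by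
    intro x y hinf
    refine hT (a := (ψ x, ψ y)) (mem_sInter.2 fun A hA => ?_)
    obtain ⟨m, rfl⟩ : A ∈ range O := hO ▸ mem_insert_of_mem _ hA
    obtain ⟨n, ⟨hx, hy⟩, hmn⟩ := hinf.exists_gt m
    exact mem_iInter₂.1 (hψD x y n hx hy).2 m (by simp; omega)
  refine ⟨φ ∘ ψ, hφ.comp hψ, fun x y hxy => ?_, fun x y => ⟨hψE x y, fun hxy => ?_⟩⟩
  · by_contra hne
    obtain ⟨n, hn⟩ := Function.ne_iff.1 hne
    rcases hx : x n <;> rcases hy : y n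
    · simp [hx, hy] at hn
    · exact (hψD x y n hx hy).1 hxy
    · exact (hψD y x n hy hx).1 hxy.symm
    · simp [hx, hy] at hn
  · have hu : {n | x n ≠ y n} =
        {n | x n = false ∧ y n = true} ∪ {n | y n = false ∧ x n = true} := by
      ext n
      rcases hx : x n <;> rcases hy : y n <;> simp [hx, hy]
    rw [E0, hu, Set.finite_union]
    exact ⟨Set.not_infinite.1 fun h => hnot x y h hxy,
      Set.not_infinite.1 fun h => hnot y x h (hE.symm hxy)⟩

end GlimmEffros

/-- Harrington–Kechris–Louveau / Glimm–Effros dichotomy: a Borel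
equivalence relation `E` on a Polish space `X` is either smooth (admits a Borel
reduction to equality on `2^ℕ`), or `E₀` continuously injectively embeds into `E`. -/
theorem glimm_effros_dichotomy
    {X : Type*} [TopologicalSpace X] [PolishSpace X]
    (E : X → X → Prop) (hE : Equivalence E)
    (hBorel : MeasurableSet[borel (X × X)] {p : X × X | E p.1 p.2}) :
    (∃ θ : X → (ℕ → Bool),
        @Measurable X (ℕ → Bool) (borel X) (borel (ℕ → Bool)) θ ∧
        ∀ x y : X, E x y ↔ θ x = θ y) ∨
    (∃ f : (ℕ → Bool) → X, Continuous f ∧ Function.Injective f ∧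
        ∀ a b : ℕ → Bool, E0 a b ↔ E (f a) (f b)) := by
  borelize X
  have hB : MeasurableSet {p : X × X | E p.1 p.2} := by
    rwa [BorelSpace.measurable_eq (α := X × X)]
  rw [← BorelSpace.measurable_eq (α := ℕ → Bool)]
  refine or_iff_not_imp_left.2 fun hsm => ?_
  have hns : ∀ 𝒞, GlimmEffros.IsInvariantFamily E 𝒞 →
      ∃ x y, GlimmEffros.Indist 𝒞 x y ∧ ¬ E x y := by
    intro 𝒞 h𝒞
    by_contra! hcon
    exact hsm (GlimmEffros.exists_measurable_reduction h𝒞 hcon)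
  obtain ⟨x, y, -, hxy⟩ := hns ∅ ⟨Set.countable_empty, by simp, by simp⟩
  have h0 := hB.compl.analyticSet
  have h1 := hB.analyticSet
  rw [AnalyticSet] at h0 h1
  obtain h | ⟨g0, hg0, hr0⟩ := h0
  · exact absurd (show (x, y) ∈ {p : X × X | E p.1 p.2}ᶜ from hxy) (h ▸ Set.notMem_empty _)
  obtain h | ⟨g1, hg1, hr1⟩ := h1
  · exact absurd (show (x, x) ∈ {p : X × X | E p.1 p.2} from hE.refl x) (h ▸ Set.notMem_empty _)
  obtain ⟨a, b, hab⟩ := GlimmEffros.exists_densePrefixes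
  let := TopologicalSpace.upgradeIsCompletelyMetrizable X
  let := TopologicalSpace.upgradeIsCompletelyMetrizable (ℕ → ℕ)
  obtain ⟨φ, hφ, hedge⟩ := GlimmEffros.exists_homomorphism (W := ℕ → ℕ) (a := a) (b := b)
    (g := fun n => if Even n then g0 else g1) hE hB
    (fun n => by split_ifs <;> assumption) (fun n hn => by simp only [if_pos hn]; exact hr0)
    (fun n hn => by simp only [if_neg hn]; exact hr1) hab.eq_of_even hns
  exact GlimmEffros.exists_embedding_of_homomorphism hE hB hab hφ hedge
end

section
/- Let E be a Borel equivalence relation on a Polish space such that E is Borel reducible to E₁. Then either E is Borel reducible to E₀, or E₁ is Borel reducible to E (so that E is Borel bireducible with E₁). -/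
open MeasureTheory

/-- Borel reducibility: a Borel-measurable map `θ` with `E x x' ↔ F (θ x) (θ x')`. -/
def BorelReducible {X Y : Type*} [TopologicalSpace X] [TopologicalSpace Y]
    (E : X → X → Prop) (F : Y → Y → Prop) : Prop :=
  ∃ θ : X → Y, @Measurable X Y (borel X) (borel Y) θ ∧
    ∀ x x' : X, E x x' ↔ F (θ x) (θ x')

/-- `E₁`: eventual equality on `(2^ℕ)^ℕ`. -/
def E1 (x y : ℕ → ℕ → Bool) : Prop := {k : ℕ | x k ≠ y k}.Finite

namespace ThirdDichotomy

open Filter Set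

/-- The tail `(z m, z (m + 1), …)` of a sequence. -/
def tail (m : ℕ) (z : ℕ → ℕ → Bool) : ℕ → ℕ → Bool := fun j => z (m + j)

lemma measurable_tail (m : ℕ) : Measurable (tail m) :=
  measurable_pi_lambda _ fun j => measurable_pi_apply (m + j)

lemma tail_congr {m : ℕ} {z z' : ℕ → ℕ → Bool} (h : ∀ j, m ≤ j → z j = z' j) :
    tail m z = tail m z' :=
  funext fun _ => h _ (Nat.le_add_right _ _)

lemma tail_eq_iff {m : ℕ} {z z' : ℕ → ℕ → Bool} :
    tail m z = tail m z' ↔ ∀ j, m ≤ j → z j = z' j := by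
  refine ⟨fun h j hj => ?_, tail_congr⟩
  have := congrFun h (j - m)
  simpa [tail, Nat.add_sub_cancel' hj] using this

lemma E1_iff {u v : ℕ → ℕ → Bool} : E1 u v ↔ ∃ k, ∀ j, k ≤ j → u j = v j := by
  have : E1 u v ↔ ∀ᶠ k in cofinite, u k = v k := Iff.rfl
  rw [this, Nat.cofinite_eq_atTop, eventually_atTop]

/-- Eventual equality of sequences with countably many values in each coordinate
reduces to `E₀`. -/
lemma reduces_of_eventually_eq {Z : Type*} [MeasurableSpace Z] {C : ℕ → Type*}
    [∀ n, Countable (C n)] [∀ n, MeasurableSpace (C n)] [∀ n, MeasurableSingletonClass (C n)]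
    (w : ∀ n, Z → C n) (hw : ∀ n, Measurable (w n)) :
    ∃ Φ : Z → ℕ → Bool, Measurable Φ ∧
      ∀ z z', (∃ N, ∀ n, N ≤ n → w n z = w n z') ↔ E0 (Φ z) (Φ z') := by
  classical
  have hinj : ∀ n, ∃ e : C n → ℕ, Function.Injective e := fun n => Countable.exists_injective_nat _
  choose e he using hinj
  have hv : ∀ n, Measurable fun z => e n (w n z) := fun n =>
    (Measurable.of_discrete).comp (hw n)
  refine ⟨fun z m => decide (e m.unpair.1 (w m.unpair.1 z) = m.unpair.2), ?_, fun z z' => ?_⟩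
  · refine measurable_pi_lambda _ fun m => ?_
    exact (Measurable.of_discrete (f := fun a : ℕ => decide (a = m.unpair.2))).comp (hv _)
  · constructor
    · rintro ⟨N, hN⟩
      refine Set.Finite.subset (s := ⋃ n ∈ Finset.range N,
        {Nat.pair n (e n (w n z)), Nat.pair n (e n (w n z'))}) ?_ ?_
      · exact Set.Finite.biUnion (Finset.finite_toSet _) fun n _ => by simp
      · intro m hm
        have hlt : m.unpair.1 < N := by
          by_contra hge
          exact hm (by simp only [hN _ (not_lt.1 hge)])
        simp only [mem_iUnion, Finset.mem_range]
        refine ⟨m.unpair.1, hlt, ?_⟩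
        by_contra hcon
        simp only [mem_insert_iff, mem_singleton_iff, not_or] at hcon
        refine hm ?_
        have h1 : e m.unpair.1 (w m.unpair.1 z) ≠ m.unpair.2 := fun h => hcon.1 (by simp [h])
        have h2 : e m.unpair.1 (w m.unpair.1 z') ≠ m.unpair.2 := fun h => hcon.2 (by simp [h])
        simp [h1, h2]
    · intro h
      obtain ⟨N, hN⟩ := h.bddAbove
      refine ⟨N + 1, fun n hn => ?_⟩
      by_contra hne
      have key : ∀ m : ℕ, m.unpair.1 = n → m.unpair.2 = e n (w n z) →
          decide (e m.unpair.1 (w m.unpair.1 z) = m.unpair.2) ≠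
          decide (e m.unpair.1 (w m.unpair.1 z') = m.unpair.2) := by
        rintro m rfl hm
        have : e _ (w m.unpair.1 z') ≠ e _ (w m.unpair.1 z) := fun h => hne (he _ h).symm
        simp [hm, this]
      have hm := key (Nat.pair n (e n (w n z))) (by simp) (by simp)
      have := hN hm
      have := Nat.left_le_pair n (e n (w n z))
      omega

/-- The least code of the `i`-th coordinate of `z` in terms of the later coordinates. -/
noncomputable def code (f : ℕ → ℕ → (ℕ → ℕ → Bool) → ℕ → Bool) (i : ℕ) (z : ℕ → ℕ → Bool) : ℕ :=
  sInf {n | z i = f i n (tail (i + 1) z)}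

/-- Recompute the coordinates below `m` from the later ones, using the codes `c`. -/
def decode (f : ℕ → ℕ → (ℕ → ℕ → Bool) → ℕ → Bool) (c : ℕ → ℕ) :
    ℕ → (ℕ → ℕ → Bool) → ℕ → ℕ → Bool
  | 0, z => z
  | m + 1, z => decode f c m (Function.update z m (f m (c m) (tail (m + 1) z)))

section Decode

variable {f : ℕ → ℕ → (ℕ → ℕ → Bool) → ℕ → Bool}

lemma measurable_code (hf : ∀ i n, Measurable (f i n)) (i : ℕ) : Measurable (code f i) := by
  have hP : ∀ n, MeasurableSet {z : ℕ → ℕ → Bool | z i = f i n (tail (i + 1) z)} := fun n =>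
    measurableSet_eq_fun (measurable_pi_apply i) ((hf i n).comp (measurable_tail _))
  refine measurable_to_countable' fun a => ?_
  have : code f i ⁻¹' {a} = ({z | z i = f i a (tail (i + 1) z)} ∩
      ⋂ b, ⋂ (_ : b < a), {z | z i = f i b (tail (i + 1) z)}ᶜ) ∪
      ({_z | a = 0} ∩ ⋂ b, {z | z i = f i b (tail (i + 1) z)}ᶜ) := by
    ext z
    simp only [mem_preimage, mem_singleton_iff, mem_union, mem_inter_iff, mem_iInter, mem_compl_iff,
      mem_ofPred_eq]
    constructor
    · intro h
      by_cases hne : {n | z i = f i n (tail (i + 1) z)}.Nonempty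
      · left
        have h1 := Nat.sInf_mem hne
        refine ⟨?_, fun b hb hb' => ?_⟩
        · rw [← h]; exact h1
        · rw [← h] at hb; exact Nat.notMem_of_lt_sInf hb hb'
      · right
        have hem := not_nonempty_iff_eq_empty.1 hne
        refine ⟨?_, fun b hb => hne ⟨b, hb⟩⟩
        rw [← h, code, hem, Nat.sInf_empty]
    · rintro (⟨h1, h2⟩ | ⟨rfl, h2⟩)
      · refine le_antisymm (Nat.sInf_le h1) (not_lt.1 fun hlt => h2 _ hlt ?_)
        exact Nat.sInf_mem (s := {n | z i = f i n (tail (i + 1) z)}) ⟨a, h1⟩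
      · have : {n | z i = f i n (tail (i + 1) z)} = ∅ := eq_empty_of_forall_notMem h2
        rw [code, this, Nat.sInf_empty]
  rw [this]
  exact ((hP a).inter (.iInter fun b => .iInter fun _ => (hP b).compl)).union
    ((MeasurableSet.const _).inter (.iInter fun b => (hP b).compl))

lemma code_congr {i : ℕ} {z z' : ℕ → ℕ → Bool} (h : ∀ j, i ≤ j → z j = z' j) :
    code f i z = code f i z' := by
  rw [code, code, h i le_rfl, tail_congr (m := i + 1) fun j hj => h j (by omega)]

lemma code_spec {i : ℕ} {z : ℕ → ℕ → Bool} (h : ∃ n, z i = f i n (tail (i + 1) z)) :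
    z i = f i (code f i z) (tail (i + 1) z) :=
  Nat.sInf_mem (s := {n | z i = f i n (tail (i + 1) z)}) h

lemma measurable_decode (hf : ∀ i n, Measurable (f i n)) (c : ℕ → ℕ) (m : ℕ) :
    Measurable (decode f c m) := by
  induction m with
  | zero => exact measurable_id
  | succ m ih =>
    refine ih.comp (measurable_pi_lambda _ fun j => ?_)
    by_cases hj : j = m
    · subst hj
      simpa [Function.comp_def] using (hf j (c j)).comp (measurable_tail (j + 1))
    · simpa [Function.update_of_ne hj] using measurable_pi_apply j

lemma decode_congr {c : ℕ → ℕ} {m : ℕ} {z z' : ℕ → ℕ → Bool} (h : ∀ j, m ≤ j → z j = z' j) :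
    decode f c m z = decode f c m z' := by
  induction m generalizing z z' with
  | zero => exact funext fun j => h j (Nat.zero_le j)
  | succ m ih =>
    refine ih fun j hj => ?_
    rw [tail_congr h]
    rcases hj.eq_or_lt with rfl | hj
    · simp
    · simp [Function.update_of_ne hj.ne', h j hj]

lemma decode_eq {c : ℕ → ℕ} {m J : ℕ} {z z' : ℕ → ℕ → Bool} (hz : ∀ j, J ≤ j → z j = z' j)
    (h : ∀ i, J ≤ i → i < m → z' i = f i (c i) (tail (i + 1) z')) :
    ∀ j, J ≤ j → decode f c m z j = z' j := by
  induction m generalizing z with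
  | zero => exact hz
  | succ m ih =>
    refine ih (fun j hj => ?_) fun i hi him => h i hi (by omega)
    by_cases hjm : j = m
    · subst hjm
      rw [Function.update_self, h j hj (by omega),
        tail_congr (z := z) (z' := z') fun i hi => hz i (by omega)]
    · rw [Function.update_of_ne hjm, hz j hj]

/-- The largest `m ≤ n` such that the codes of all coordinates below `m` are at most `n`. -/
noncomputable def bound (f : ℕ → ℕ → (ℕ → ℕ → Bool) → ℕ → Bool) (n : ℕ)
    (z : ℕ → ℕ → Bool) : ℕ :=
  open Classical in Nat.findGreatest (fun m => ∀ i < m, code f i z ≤ n) n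

lemma measurable_bound (hf : ∀ i n, Measurable (f i n)) (n : ℕ) : Measurable (bound f n) := by
  classical
  refine measurable_findGreatest fun k _ => ?_
  have : {z | ∀ i < k, code f i z ≤ n} = ⋂ i, ⋂ (_ : i < k), code f i ⁻¹' Iic n := by
    ext z; simp
  rw [this]
  exact .iInter fun i => .iInter fun _ => measurable_code hf i measurableSet_Iic

lemma code_le_of_lt_bound {n i : ℕ} {z : ℕ → ℕ → Bool} (hi : i < bound f n z) :
    code f i z ≤ n := by
  classical
  exact Nat.findGreatest_spec (P := fun m => ∀ i < m, code f i z ≤ n) (Nat.zero_le n)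
    (by simp) i hi

/-- Extension by zero of a bounded finite sequence of codes. -/
def extend {n : ℕ} (c : Fin n → Fin (n + 1)) (i : ℕ) : ℕ :=
  if h : i < n then c ⟨i, h⟩ else 0

/-- The `n`-th finite approximation to `z` used in the reduction to `E₀`. -/
noncomputable def approx (f : ℕ → ℕ → (ℕ → ℕ → Bool) → ℕ → Bool) (n : ℕ) (z : ℕ → ℕ → Bool) :
    ℕ × ℕ × ((Fin n → Fin (n + 1)) → Fin n → Fin n → Bool) :=
  (bound f n z, code f n z, fun c i b => decode f (extend c) (bound f n z) z i b)

lemma measurable_approx (hf : ∀ i n, Measurable (f i n)) (n : ℕ) : Measurable (approx f n) := by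
  refine (measurable_bound hf n).prodMk ((measurable_code hf n).prodMk ?_)
  refine measurable_pi_lambda _ fun c => measurable_pi_lambda _ fun i =>
    measurable_pi_lambda _ fun b => ?_
  have h : Measurable fun p : (ℕ → ℕ → Bool) × ℕ => decode f (extend c) p.2 p.1 :=
    measurable_from_prod_countable_left fun m => measurable_decode hf _ m
  have h' := h.comp (measurable_id.prodMk (measurable_bound hf n))
  exact (measurable_pi_apply (b : ℕ)).comp ((measurable_pi_apply (i : ℕ)).comp h')

lemma approx_eventually_eq {z z' : ℕ → ℕ → Bool} {N : ℕ} (h : ∀ j, N ≤ j → z j = z' j) :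
    ∃ M, ∀ n, M ≤ n → approx f n z = approx f n z' := by
  classical
  obtain ⟨B, hB⟩ : ∃ B, ∀ i < N, code f i z ≤ B ∧ code f i z' ≤ B := by
    refine ⟨(Finset.range N).sup fun i => max (code f i z) (code f i z'), fun i hi => ?_⟩
    have := Finset.le_sup (f := fun i => max (code f i z) (code f i z')) (Finset.mem_range.2 hi)
    exact ⟨(le_max_left _ _).trans this, (le_max_right _ _).trans this⟩
  have hcode : ∀ i, N ≤ i → code f i z = code f i z' := fun i hi =>
    code_congr fun j hj => h j (hi.trans hj)
  refine ⟨max N B, fun n hn => ?_⟩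
  have hNn : N ≤ n := (le_max_left _ _).trans hn
  have hBn : B ≤ n := (le_max_right _ _).trans hn
  have hb : bound f n z = bound f n z' := by
    have : (fun m => ∀ i < m, code f i z ≤ n) = fun m => ∀ i < m, code f i z' ≤ n := by
      funext m
      refine propext (forall₂_congr fun i _ => ?_)
      rcases lt_or_ge i N with hi | hi
      · exact iff_of_true ((hB i hi).1.trans hBn) ((hB i hi).2.trans hBn)
      · rw [hcode i hi]
    simp only [bound, this]
  have hNb : N ≤ bound f n z :=
    Nat.le_findGreatest hNn fun i hi => (hB i hi).1.trans hBn
  have hd : ∀ c, decode f c (bound f n z) z = decode f c (bound f n z) z' := fun c =>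
    decode_congr fun j hj => h j (hNb.trans hj)
  simp only [approx, ← hb, hcode n hNn, hd]

lemma eventually_eq_of_approx {z z' : ℕ → ℕ → Bool}
    (hz : ∃ J, ∀ i, J ≤ i → ∃ n, z i = f i n (tail (i + 1) z))
    (hz' : ∃ J, ∀ i, J ≤ i → ∃ n, z' i = f i n (tail (i + 1) z'))
    {N : ℕ} (h : ∀ n, N ≤ n → approx f n z = approx f n z') :
    ∃ J, ∀ i, J ≤ i → z i = z' i := by
  obtain ⟨J₁, h₁⟩ := hz
  obtain ⟨J₂, h₂⟩ := hz'
  refine ⟨max N (max J₁ J₂), fun i hi => funext fun b => ?_⟩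
  set J := max N (max J₁ J₂) with hJ
  have hNJ : N ≤ J := le_max_left _ _
  have hJ₁ : J₁ ≤ J := (le_max_left _ _).trans (le_max_right _ _)
  have hJ₂ : J₂ ≤ J := (le_max_right _ _).trans (le_max_right _ _)
  have hcode : ∀ i, N ≤ i → code f i z = code f i z' := fun i hi =>
    congrArg (fun a => a.2.1) (h i hi)
  let n := i + b + 1
  have hn := h n (by omega)
  have hb : bound f n z = bound f n z' := congrArg (fun a => a.1) hn
  have hbn : bound f n z ≤ n := by
    classical
    exact Nat.findGreatest_le n
  let c : Fin n → Fin (n + 1) := fun i =>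
    if hi : (i : ℕ) < bound f n z then ⟨code f i z, Nat.lt_succ_of_le (code_le_of_lt_bound hi)⟩
    else 0
  have hc : ∀ i, i < bound f n z → extend c i = code f i z := fun i hi => by
    have : i < n := by omega
    simp [extend, this, c, hi]
  have hd : decode f (extend c) (bound f n z) z i b = decode f (extend c) (bound f n z') z' i b :=
    congrFun (congrFun (congrFun (congrArg (fun a => a.2.2) hn) c) ⟨i, by omega⟩) ⟨b, by omega⟩
  rw [decode_eq (z' := z) (J := J) (fun _ _ => rfl), decode_eq (z' := z') (J := J)
    (fun _ _ => rfl)] at hd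
  · exact hd
  · intro l hl hlb
    rw [hc l (hb ▸ hlb), hcode l (hNJ.trans hl)]
    exact code_spec (h₂ l (hJ₂.trans hl))
  · exact hi
  · intro l hl hlb
    rw [hc l hlb]
    exact code_spec (h₁ l (hJ₁.trans hl))
  · exact hi

/-- On the sequences almost all of whose coordinates are given by countably many Borel functions
of the later coordinates, `E₁` reduces to `E₀`. -/
lemma exists_reduction_E0 (hf : ∀ i n, Measurable (f i n)) :
    ∃ Φ : (ℕ → ℕ → Bool) → ℕ → Bool, Measurable Φ ∧ ∀ z z',
      (∃ J, ∀ i, J ≤ i → ∃ n, z i = f i n (tail (i + 1) z)) →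
      (∃ J, ∀ i, J ≤ i → ∃ n, z' i = f i n (tail (i + 1) z')) → (E1 z z' ↔ E0 (Φ z) (Φ z')) := by
  obtain ⟨Φ, hΦ, h⟩ := reduces_of_eventually_eq (approx f) (measurable_approx hf)
  refine ⟨Φ, hΦ, fun z z' hz hz' => ?_⟩
  rw [← h, E1_iff]
  exact ⟨fun ⟨_, hN⟩ => approx_eventually_eq hN, fun ⟨_, hN⟩ => eventually_eq_of_approx hz hz' hN⟩

end Decode

/-- A measurable function on a measurable set which depends only on another measurable function
factors through it in a measurable way. -/
lemma exists_measurable_factor {P : Type*} [MeasurableSpace P] [StandardBorelSpace P] {S : Set P}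
    (hS : MeasurableSet S) {a : P → ℕ → ℕ → Bool} (ha : Measurable a) {v : P → ℕ → Bool}
    (hv : Measurable v) (h : ∀ p ∈ S, ∀ p' ∈ S, a p = a p' → v p = v p') :
    ∃ g : (ℕ → ℕ → Bool) → ℕ → Bool, Measurable g ∧ ∀ p ∈ S, v p = g (a p) := by
  classical
  have hSb : ∀ c b, AnalyticSet (a '' (S ∩ {p | v p c = b})) := fun c b =>
    (hS.inter (((measurable_pi_apply c).comp hv) (measurableSet_singleton b))).analyticSet_image ha
  have hsep : ∀ c, MeasurablySeparable (a '' (S ∩ {p | v p c = true}))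
      (a '' (S ∩ {p | v p c = false})) := by
    refine fun c => (hSb c true).measurablySeparable (hSb c false) ?_
    rw [Set.disjoint_left]
    rintro _ ⟨p, ⟨hp, hpc⟩, rfl⟩ ⟨p', ⟨hp', hpc'⟩, hpp⟩
    have hvc := h p' hp' p hp hpp
    simp only [mem_ofPred_eq] at hpc hpc'
    rw [hvc, hpc] at hpc'
    exact absurd hpc' (by simp)
  choose B hB₁ hB₂ hB using hsep
  refine ⟨fun y c => decide (y ∈ B c), measurable_pi_lambda _ fun c => ?_, fun p hp => ?_⟩
  · exact measurable_to_bool (by convert hB c using 1; ext y; simp)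
  · funext c
    cases hc : v p c with
    | true => exact (decide_eq_true (hB₁ c ⟨p, ⟨hp, hc⟩, rfl⟩)).symm
    | false => exact (decide_eq_false (Set.disjoint_left.1 (hB₂ c) ⟨p, ⟨hp, hc⟩, rfl⟩)).symm

/-- The `i`-th coordinate of `z` is not given by any of the functions `f i n`. -/
def IsFresh (f : ℕ → ℕ → (ℕ → ℕ → Bool) → ℕ → Bool) (i : ℕ) (z : ℕ → ℕ → Bool) : Prop :=
  ∀ n, z i ≠ f i n (tail (i + 1) z)

/-- All the coordinates in `I`, and infinitely many coordinates overall, are fresh. -/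
def Avoids (f : ℕ → ℕ → (ℕ → ℕ → Bool) → ℕ → Bool) (I : Set ℕ) (z : ℕ → ℕ → Bool) : Prop :=
  (∀ i ∈ I, IsFresh f i z) ∧ ∃ᶠ i in atTop, IsFresh f i z

lemma measurableSet_avoids {f : ℕ → ℕ → (ℕ → ℕ → Bool) → ℕ → Bool}
    (hf : ∀ i n, Measurable (f i n)) (I : Set ℕ) : MeasurableSet {z | Avoids f I z} := by
  have hF : ∀ i, MeasurableSet {z | IsFresh f i z} := fun i => by
    have : {z | IsFresh f i z} = ⋂ n, {z | z i = f i n (tail (i + 1) z)}ᶜ := by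
      ext z; simp [IsFresh]
    rw [this]
    exact .iInter fun n => (measurableSet_eq_fun (measurable_pi_apply i)
      ((hf i n).comp (measurable_tail _))).compl
  have : {z | Avoids f I z} = (⋂ i ∈ I, {z | IsFresh f i z}) ∩
      ⋂ N, ⋃ i, ⋃ (_ : N ≤ i), {z | IsFresh f i z} := by
    ext z; simp [Avoids, frequently_atTop]
  rw [this]
  exact (MeasurableSet.biInter (Set.to_countable I) fun i _ => hF i).inter
    (.iInter fun N => .iUnion fun i => .iUnion fun _ => hF i)

lemma IsFresh.mono {f g : ℕ → ℕ → (ℕ → ℕ → Bool) → ℕ → Bool}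
    (hfg : ∀ i n, ∃ m, f i n = g i m) {i : ℕ} {z : ℕ → ℕ → Bool} (h : IsFresh g i z) :
    IsFresh f i z := fun n => by
  obtain ⟨m, hm⟩ := hfg i n
  exact hm ▸ h m

lemma Avoids.mono {f g : ℕ → ℕ → (ℕ → ℕ → Bool) → ℕ → Bool}
    (hfg : ∀ i n, ∃ m, f i n = g i m) {I : Set ℕ} {z : ℕ → ℕ → Bool} (h : Avoids g I z) :
    Avoids f I z :=
  ⟨fun i hi => (h.1 i hi).mono hfg, h.2.mono fun _ hi => hi.mono hfg⟩

/-- A set of configurations is positive if, for every countable family of Borel functions, it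
contains a configuration all of whose points avoid the family. -/
def Positive {X L : Type*} (θ : X → ℕ → ℕ → Bool) (I : Set ℕ) (G : Set (L → X)) : Prop :=
  ∀ f : ℕ → ℕ → (ℕ → ℕ → Bool) → ℕ → Bool, (∀ i n, Measurable (f i n)) →
    ∃ γ ∈ G, ∀ s, Avoids f I (θ (γ s))

section Positive

variable {X L : Type*} {θ : X → ℕ → ℕ → Bool}

lemma Positive.mono {I : Set ℕ} {G G' : Set (L → X)} (h : Positive θ I G) (hG : G ⊆ G') :
    Positive θ I G' := fun f hf => by
  obtain ⟨γ, hγ, h⟩ := h f hf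
  exact ⟨γ, hG hγ, h⟩

lemma exists_positive {ι : Type*} [Countable ι] {I : ι → Set ℕ} {G : ι → Set (L → X)}
    (h : ∀ f : ℕ → ℕ → (ℕ → ℕ → Bool) → ℕ → Bool, (∀ i n, Measurable (f i n)) →
      ∃ j, ∃ γ ∈ G j, ∀ s, Avoids f (I j) (θ (γ s))) : ∃ j, Positive θ (I j) (G j) := by
  by_contra hcon
  simp only [Positive, not_exists, not_forall] at hcon
  choose f hf hcon using hcon
  have : Nonempty ι := by
    obtain ⟨j, -⟩ := h (fun _ _ _ _ => false) fun _ _ => measurable_const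
    exact ⟨j⟩
  obtain ⟨e, he⟩ := exists_surjective_nat ι
  obtain ⟨j, γ, hγ, hav⟩ := h (fun i n => f (e n.unpair.1) i n.unpair.2) fun i n => hf _ _ _
  refine hcon j γ ⟨hγ, fun s => (hav s).mono fun i n => ?_⟩
  obtain ⟨a, rfl⟩ := he j
  exact ⟨Nat.pair a n, by simp⟩

lemma Positive.exists_of_subset_iUnion {ι : Type*} [Countable ι] {I : Set ℕ} {G : Set (L → X)}
    {G' : ι → Set (L → X)} (h : Positive θ I G) (hG : G ⊆ ⋃ j, G' j) :
    ∃ j, Positive θ I (G' j) :=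
  exists_positive fun f hf => by
    obtain ⟨γ, hγ, hav⟩ := h f hf
    obtain ⟨j, hj⟩ := mem_iUnion.1 (hG hγ)
    exact ⟨j, γ, hj, hav⟩

/-- The pairs of configurations in `G` which agree after the coordinate `i`, differ at the
coordinate `i` on the blocks in `T`, and are equal on the other blocks. -/
def splitOn {K : Type*} (θ : X → ℕ → ℕ → Bool) (κ : L → K) (i : ℕ) (G : Set (L → X)) (T : Set K) :
    Set (L × Bool → X) :=
  {γ | (fun s => γ (s, false)) ∈ G ∧ (fun s => γ (s, true)) ∈ G ∧
    (∀ s, ∀ j, i < j → θ (γ (s, false)) j = θ (γ (s, true)) j) ∧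
    (∀ s, κ s ∈ T → θ (γ (s, false)) i ≠ θ (γ (s, true)) i) ∧
    ∀ s, κ s ∉ T → γ (s, false) = γ (s, true)}

lemma measurableSet_splitOn [MeasurableSpace X] [StandardBorelSpace X] [Countable L] {K : Type*}
    (hθ : Measurable θ) (κ : L → K) (i : ℕ) {G : Set (L → X)} (hG : MeasurableSet G) (T : Set K) :
    MeasurableSet (splitOn θ κ i G T) := by
  have hθ' : ∀ p j, Measurable fun γ : L × Bool → X => θ (γ p) j := fun p j =>
    (measurable_pi_apply j).comp (hθ.comp (measurable_pi_apply p))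
  have hhalf : ∀ e, Measurable fun (γ : L × Bool → X) (s : L) => γ (s, e) := fun e =>
    measurable_pi_lambda _ fun s => measurable_pi_apply (s, e)
  have h₃ : MeasurableSet {γ : L × Bool → X |
      ∀ s, ∀ j, i < j → θ (γ (s, false)) j = θ (γ (s, true)) j} := by
    simp only [ofPred_forall]
    exact .iInter fun s => .iInter fun j => .iInter fun _ =>
      measurableSet_eq_fun (hθ' _ _) (hθ' _ _)
  have h₄ : MeasurableSet {γ : L × Bool → X |
      ∀ s, κ s ∈ T → θ (γ (s, false)) i ≠ θ (γ (s, true)) i} := by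
    simp only [ofPred_forall]
    exact .iInter fun s => .iInter fun _ => (measurableSet_eq_fun (hθ' _ _) (hθ' _ _)).compl
  have h₅ : MeasurableSet {γ : L × Bool → X | ∀ s, κ s ∉ T → γ (s, false) = γ (s, true)} := by
    simp only [ofPred_forall]
    exact .iInter fun s => .iInter fun _ =>
      measurableSet_eq_fun (measurable_pi_apply _) (measurable_pi_apply _)
  exact (hhalf false hG).inter ((hhalf true hG).inter (h₃.inter (h₄.inter h₅)))

/-- Splitting one more block preserves positivity. -/
lemma Positive.splitOn_insert [MeasurableSpace X] [StandardBorelSpace X] [Countable L] {K : Type*}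
    (hθ : Measurable θ) {κ : L → K} {i : ℕ} {I : Set ℕ} (hi : i ∈ I) {G : Set (L → X)}
    (hG : MeasurableSet G)
    (hκ : ∀ γ ∈ G, ∀ s s', κ s = κ s' → ∀ j, i ≤ j → θ (γ s) j = θ (γ s') j)
    (hamalg : ∀ γ ∈ G, ∀ δ ∈ G, ∀ q, (∀ s, κ s = q → ∀ j, i < j → θ (γ s) j = θ (δ s) j) →
      ∀ ε : L → X, (∀ s, κ s = q → ε s = δ s) → (∀ s, κ s ≠ q → ε s = γ s) → ε ∈ G)
    {T : Set K} {q : K} (hq : q ∉ T) (hpos : Positive θ I (splitOn θ κ i G T)) :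
    Positive θ I (splitOn θ κ i G (insert q T)) := by
  classical
  by_cases hqs : ∃ s, κ s = q
  swap
  · push Not at hqs
    refine hpos.mono fun γ hγ => ⟨hγ.1, hγ.2.1, hγ.2.2.1, fun s hs => ?_, fun s hs => ?_⟩
    · exact hγ.2.2.2.1 s (hs.resolve_left (hqs s))
    · exact hγ.2.2.2.2 s fun h => hs (Or.inr h)
  obtain ⟨sq, hsq⟩ := hqs
  intro f hf
  by_contra hcon
  push Not at hcon
  let S : Set (L × Bool → X) := splitOn θ κ i G T ∩ {γ | ∀ p, Avoids f I (θ (γ p))}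
  have hS : MeasurableSet S := by
    refine (measurableSet_splitOn hθ κ i hG T).inter ?_
    simp only [ofPred_forall]
    exact .iInter fun p => (hθ.comp (measurable_pi_apply p)) (measurableSet_avoids hf I)
  have hθp : Measurable fun γ : L × Bool → X => θ (γ (sq, true)) :=
    hθ.comp (measurable_pi_apply _)
  obtain ⟨h, hh, hfac⟩ := exists_measurable_factor hS
    (a := fun γ => tail (i + 1) (θ (γ (sq, true)))) (v := fun γ => θ (γ (sq, true)) i)
    ((measurable_tail _).comp hθp) ((measurable_pi_apply i).comp hθp) (by
      rintro γ ⟨⟨hγ₁, hγ₂, hγ₃, hγ₄, hγ₅⟩, hγ⟩ δ ⟨⟨hδ₁, hδ₂, hδ₃, hδ₄, hδ₅⟩, hδ⟩ htail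
      by_contra hne
      rw [tail_eq_iff] at htail
      let ε : L × Bool → X := fun p => if κ p.1 = q ∧ p.2 = true then δ p else γ p
      have hεf : ∀ s, ε (s, false) = γ (s, false) := fun s => by simp [ε]
      have hεq : ∀ s, κ s = q → ε (s, true) = δ (s, true) := fun s hs => by simp [ε, hs]
      have hεn : ∀ s, κ s ≠ q → ε (s, true) = γ (s, true) := fun s hs => by simp [ε, hs]
      have hγδ : ∀ s, κ s = q → ∀ j, i < j → θ (γ (s, true)) j = θ (δ (s, true)) j :=
        fun s hs j hj => by
          rw [hκ _ hγ₂ s sq (hs.trans hsq.symm) j hj.le, htail j hj,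
            hκ _ hδ₂ sq s (hsq.trans hs.symm) j hj.le]
      suffices hε : ε ∈ splitOn θ κ i G (insert q T) by
        obtain ⟨p, hp⟩ := hcon ε hε
        refine hp ?_
        by_cases hc : κ p.1 = q ∧ p.2 = true
        · simpa only [ε, if_pos hc] using hδ p
        · simpa only [ε, if_neg hc] using hγ p
      refine ⟨?_, ?_, ?_, ?_, ?_⟩
      · simpa only [hεf] using hγ₁
      · exact hamalg _ hγ₂ _ hδ₂ q hγδ _ hεq hεn
      · intro s j hj
        by_cases hs : κ s = q
        · rw [hεf, hεq s hs, hγ₃ s j hj, hγδ s hs j hj]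
        · rw [hεf, hεn s hs, hγ₃ s j hj]
      · intro s hsT
        by_cases hs : κ s = q
        · rw [hεf, hεq s hs, hγ₅ s (hs ▸ hq), hκ _ hγ₂ s sq (hs.trans hsq.symm) i le_rfl,
            hκ _ hδ₂ s sq (hs.trans hsq.symm) i le_rfl]
          exact hne
        · rw [hεf, hεn s hs]
          exact hγ₄ s (hsT.resolve_left hs)
      · intro s hsT
        rw [hεf, hεn s fun h => hsT (Or.inl h), hγ₅ s fun h => hsT (Or.inr h)])
  obtain ⟨γ, hγ, hav⟩ := hpos (fun i n => n.casesOn h (f i)) (by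
    rintro i (_ | n)
    · exact hh
    · exact hf i n)
  have hγS : γ ∈ S := ⟨hγ, fun p => (hav p).mono fun i n => ⟨n + 1, rfl⟩⟩
  exact (hav (sq, true)).1 i hi 0 (hfac γ hγS)

/-- A positive set of configurations can be split simultaneously on all blocks. -/
lemma Positive.splitOn_univ [MeasurableSpace X] [StandardBorelSpace X] [Countable L] {K : Type*}
    [Finite K] (hθ : Measurable θ) {κ : L → K} {i : ℕ} {I : Set ℕ} (hi : i ∈ I) {G : Set (L → X)}
    (hG : MeasurableSet G)
    (hκ : ∀ γ ∈ G, ∀ s s', κ s = κ s' → ∀ j, i ≤ j → θ (γ s) j = θ (γ s') j)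
    (hamalg : ∀ γ ∈ G, ∀ δ ∈ G, ∀ q, (∀ s, κ s = q → ∀ j, i < j → θ (γ s) j = θ (δ s) j) →
      ∀ ε : L → X, (∀ s, κ s = q → ε s = δ s) → (∀ s, κ s ≠ q → ε s = γ s) → ε ∈ G)
    (hpos : Positive θ I G) : Positive θ I (splitOn θ κ i G univ) := by
  refine Set.Finite.induction_on_subset (motive := fun T _ => Positive θ I (splitOn θ κ i G T))
    univ (Set.toFinite univ) ?_ ?_
  · intro f hf
    obtain ⟨γ, hγ, hav⟩ := hpos f hf
    exact ⟨fun p => γ p.1, ⟨hγ, hγ, by simp, by simp, by simp⟩, fun p => hav p.1⟩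
  · intro q T _ _ hq ih
    exact ih.splitOn_insert hθ hi hG hκ hamalg hq

end Positive

/-- The leaves of the binary tree of height `n`. -/
def Leaf : ℕ → Type
  | 0 => Unit
  | n + 1 => Leaf n × Bool

instance Leaf.instFinite : ∀ n, Finite (Leaf n)
  | 0 => inferInstanceAs (Finite Unit)
  | n + 1 => by
    have := Leaf.instFinite n
    exact inferInstanceAs (Finite (Leaf n × Bool))

instance Leaf.instNonempty : ∀ n, Nonempty (Leaf n)
  | 0 => inferInstanceAs (Nonempty Unit)
  | n + 1 => by
    have := Leaf.instNonempty n
    exact inferInstanceAs (Nonempty (Leaf n × Bool))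

/-- The row of `(2^ℕ)^ℕ` to which the `t`-th bit belongs. -/
def row (t : ℕ) : ℕ := t.unpair.1

lemma row_le (t : ℕ) : row t ≤ t := Nat.unpair_left_le t

/-- Erase the bits of a leaf belonging to rows below `k`. -/
def mask (k : ℕ) : ∀ n, Leaf n → Leaf n
  | 0, s => s
  | n + 1, s => (mask k n s.1, if k ≤ row n then s.2 else false)

lemma mask_succ {k n : ℕ} {s s' : Leaf n} {e e' : Bool} :
    mask k (n + 1) (s, e) = mask k (n + 1) (s', e') ↔
      mask k n s = mask k n s' ∧ (k ≤ row n → e = e') := by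
  refine Prod.mk_inj.trans (and_congr_right fun _ => ?_)
  by_cases h : k ≤ row n <;> simp [h]

lemma mask_mono {k k' n : ℕ} (hk : k ≤ k') {s s' : Leaf n} (h : mask k n s = mask k n s') :
    mask k' n s = mask k' n s' := by
  induction n with
  | zero => rfl
  | succ n ih =>
    obtain ⟨s, e⟩ := s
    obtain ⟨s', e'⟩ := s'
    rw [mask_succ] at h ⊢
    exact ⟨ih h.1, fun hr => h.2 (hk.trans hr)⟩

lemma mask_of_le {k n : ℕ} (hk : n ≤ k) (s s' : Leaf n) : mask k n s = mask k n s' := by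
  induction n with
  | zero => rfl
  | succ n ih =>
    obtain ⟨s, e⟩ := s
    obtain ⟨s', e'⟩ := s'
    rw [mask_succ]
    exact ⟨ih (by omega) _ _, fun hr => absurd (hr.trans (row_le n)) (by omega)⟩

/-- The configurations with points in the sets `V s` such that, for `k ≤ n`, the points at leaves
which agree on the rows from `k` on have the same coordinates after `i 0, …, i (k - 1)`. -/
def configs {X : Type*} (θ : X → ℕ → ℕ → Bool) (n : ℕ) (i : ℕ → ℕ) (V : Leaf n → Set X) :
    Set (Leaf n → X) :=
  {γ | (∀ s, γ s ∈ V s) ∧ ∀ k, k ≤ n → ∀ s s', mask k n s = mask k n s' →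
    ∀ j, (∀ l, l < k → i l < j) → θ (γ s) j = θ (γ s') j}

lemma measurableSet_configs {X : Type*} [MeasurableSpace X] {θ : X → ℕ → ℕ → Bool}
    (hθ : Measurable θ) {n : ℕ} {i : ℕ → ℕ} {V : Leaf n → Set X} (hV : ∀ s, MeasurableSet (V s)) :
    MeasurableSet (configs θ n i V) := by
  have hθ' : ∀ p j, Measurable fun γ : Leaf n → X => θ (γ p) j := fun p j =>
    (measurable_pi_apply j).comp (hθ.comp (measurable_pi_apply p))
  simp only [configs, ofPred_and, ofPred_forall]
  exact (MeasurableSet.iInter fun s => measurable_pi_apply s (hV s)).inter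
    (.iInter fun k => .iInter fun _ => .iInter fun s => .iInter fun s' => .iInter fun _ =>
      .iInter fun j => .iInter fun _ => measurableSet_eq_fun (hθ' _ _) (hθ' _ _))

lemma configs_congr {X : Type*} {θ : X → ℕ → ℕ → Bool} {n : ℕ} {i i' : ℕ → ℕ}
    (h : ∀ k, k < n → i k = i' k) (V : Leaf n → Set X) :
    configs θ n i V = configs θ n i' V := by
  ext γ
  refine and_congr_right fun _ => forall₂_congr fun k hk => forall₃_congr fun s s' _ =>
    forall_congr' fun j => ?_
  have : (∀ l, l < k → i l < j) ↔ ∀ l, l < k → i' l < j :=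
    forall₂_congr fun l hl => by rw [h l (hl.trans_le hk)]
  rw [this]

lemma configs_amalgam {X : Type*} {θ : X → ℕ → ℕ → Bool} {n k : ℕ} {i : ℕ → ℕ}
    {V : Leaf n → Set X} {γ δ ε : Leaf n → X} (hγ : γ ∈ configs θ n i V)
    (hδ : δ ∈ configs θ n i V) {q : Leaf n}
    (h : ∀ s, mask k n s = q → ∀ j, i k < j → θ (γ s) j = θ (δ s) j)
    (hεδ : ∀ s, mask k n s = q → ε s = δ s) (hεγ : ∀ s, mask k n s ≠ q → ε s = γ s) :
    ε ∈ configs θ n i V := by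
  refine ⟨fun s => ?_, fun k' hk' s s' hss j hj => ?_⟩
  · by_cases hs : mask k n s = q
    · rw [hεδ s hs]; exact hδ.1 s
    · rw [hεγ s hs]; exact hγ.1 s
  · have hkk : ¬ (mask k n s = q ↔ mask k n s' = q) → k < k' := fun hn => by
      by_contra hlt
      exact hn (by rw [mask_mono (not_lt.1 hlt) hss])
    by_cases hs : mask k n s = q <;> by_cases hs' : mask k n s' = q
    · rw [hεδ s hs, hεδ s' hs']; exact hδ.2 k' hk' s s' hss j hj
    · rw [hεδ s hs, hεγ s' hs', ← h s hs j (hj k (hkk (by tauto)))]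
      exact hγ.2 k' hk' s s' hss j hj
    · rw [hεγ s hs, hεδ s' hs', ← h s' hs' j (hj k (hkk (by tauto)))]
      exact hγ.2 k' hk' s s' hss j hj
    · rw [hεγ s hs, hεγ s' hs']; exact hγ.2 k' hk' s s' hss j hj

lemma splitOn_subset_configs {X : Type*} {θ : X → ℕ → ℕ → Bool} {n : ℕ} {i : ℕ → ℕ}
    {V : Leaf n → Set X} {V' : Leaf (n + 1) → Set X} {γ : Leaf (n + 1) → X}
    (hγ : γ ∈ splitOn θ (mask (row n) n) (i (row n)) (configs θ n i V) univ)
    (hV' : ∀ s, γ s ∈ V' s) : γ ∈ configs θ (n + 1) i V' := by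
  refine ⟨hV', ?_⟩
  have half : ∀ e, (fun s => γ (s, e)) ∈ configs θ n i V := fun e => by
    cases e
    exacts [hγ.1, hγ.2.1]
  rintro k hk ⟨s, e⟩ ⟨s', e'⟩ hss j hj
  rw [mask_succ] at hss
  have hsame : ∀ e, θ (γ (s, e)) j = θ (γ (s', e)) j := fun e => by
    rcases Nat.lt_or_ge n k with hnk | hnk
    · exact (half e).2 n le_rfl s s' (mask_of_le le_rfl _ _) j fun l hl => hj l (by omega)
    · exact (half e).2 k hnk s s' hss.1 j hj
  by_cases hkr : k ≤ row n
  · rw [hss.2 hkr]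
    exact hsame e'
  · have hbit := hγ.2.2.1 s' j (hj _ (not_le.1 hkr))
    rw [hsame e]
    cases e <;> cases e'
    exacts [rfl, hbit, hbit.symm, rfl]

section Construction

variable {X : Type*} [MetricSpace X] [SecondCountableTopology X]
  {θ : X → ℕ → ℕ → Bool}

variable (θ) in
/-- A finite stage of the construction of a reduction of `E₁`. -/
structure Stage (n : ℕ) where
  /-- The coordinates at which the rows are separated. -/
  i : ℕ → ℕ
  /-- The neighbourhoods approximating the points at the leaves. -/
  V : Leaf n → TopologicalSpace.countableBasis X
  i_lt : ∀ k l, k < l → l < n → i k < i l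
  pos : Positive θ {a | ∃ k < n, a = i k} (configs θ n i fun s => (V s : Set X))

/-- `S'` is an admissible successor of the stage `S`. -/
structure Stage.Ext {n : ℕ} (S : Stage θ n) (S' : Stage θ (n + 1)) : Prop where
  i_eq : ∀ k, k < n → S'.i k = S.i k
  subset : ∀ s e, (S'.V (s, e) : Set X) ⊆ S.V s
  dist_lt : ∀ s, ∀ x ∈ (S'.V s : Set X), ∀ y ∈ (S'.V s : Set X), dist x y < (1 / 2) ^ n
  sep : ∀ s s', mask (row n) n s = mask (row n) n s' → ∃ c, ∀ x ∈ (S'.V (s, false) : Set X),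
    ∀ y ∈ (S'.V (s', true) : Set X), θ x (S'.i (row n)) c ≠ θ y (S'.i (row n)) c

lemma exists_mem_basis {x : X} {U : Set X} (hU : U ∈ nhds x) :
    ∃ V : TopologicalSpace.countableBasis X, x ∈ (V : Set X) ∧ (V : Set X) ⊆ U := by
  obtain ⟨V, hV, hxV, hVU⟩ :=
    (TopologicalSpace.isBasis_countableBasis X).mem_nhds_iff.1 hU
  exact ⟨⟨V, hV⟩, hxV, hVU⟩

lemma isOpen_basis (V : TopologicalSpace.countableBasis X) : IsOpen (V : Set X) :=
  TopologicalSpace.isOpen_of_mem_countableBasis V.2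

instance : Countable (TopologicalSpace.countableBasis X) :=
  (TopologicalSpace.countable_countableBasis X).to_subtype

lemma exists_stage_zero (h : Positive θ ∅ (univ : Set (Leaf 0 → X))) : Nonempty (Stage θ 0) := by
  obtain ⟨V, hV⟩ := h.exists_of_subset_iUnion (ι := Leaf 0 → TopologicalSpace.countableBasis X)
    (G' := fun V => configs θ 0 id fun s => (V s : Set X)) (by
      intro γ _
      choose V hV _ using fun s => exists_mem_basis (x := γ s) univ_mem
      exact mem_iUnion.2 ⟨V, hV, fun k hk s s' _ j _ => rfl⟩)
  refine ⟨⟨id, V, fun k l _ hl => absurd hl (by omega), ?_⟩⟩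
  convert hV using 1
  ext a
  simp

/-- A new row can be added to a stage. -/
lemma Stage.exists_new_row {n : ℕ} (S : Stage θ n) : ∃ a, (∀ k, k < n → S.i k < a) ∧
    Positive θ (insert a {a | ∃ k < n, a = S.i k}) (configs θ n S.i fun s => (S.V s : Set X)) := by
  obtain ⟨a, ha⟩ := exists_positive (θ := θ)
    (I := fun a => insert a {a | ∃ k < n, a = S.i k})
    (G := fun a => {γ | γ ∈ configs θ n S.i (fun s => (S.V s : Set X)) ∧
      ∀ k, k < n → S.i k < a}) (by
      intro f hf
      obtain ⟨γ, hγ, hav⟩ := S.pos f hf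
      have s₀ : Leaf n := Classical.arbitrary _
      have hlarge : ∀ᶠ a in atTop, ∀ k ∈ Finset.range n, S.i k < a :=
        (Finset.eventually_all _).2 fun k _ => eventually_gt_atTop _
      obtain ⟨a, hfresh, ha⟩ := ((hav s₀).2.and_eventually hlarge).exists
      have ha' : ∀ k, k < n → S.i k < a := fun k hk => ha k (Finset.mem_range.2 hk)
      refine ⟨a, γ, ⟨hγ, ha'⟩, fun s => ⟨?_, (hav s).2⟩⟩
      rintro b (rfl | hb)
      · have heq : ∀ j, b ≤ j → θ (γ s) j = θ (γ s₀) j := fun j hj =>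
          hγ.2 n le_rfl s s₀ (mask_of_le le_rfl _ _) j fun l hl => (ha' l hl).trans_le hj
        intro m
        rw [heq b le_rfl, tail_congr fun j hj => heq j (by omega)]
        exact hfresh m
      · exact (hav s).1 b hb)
  refine ⟨a, ?_, ha.mono fun γ hγ => hγ.1⟩
  obtain ⟨γ, hγ, -⟩ := ha (fun _ _ _ _ => false) fun _ _ => measurable_const
  exact hγ.2

lemma Stage.exists_ext [CompleteSpace X] [MeasurableSpace X] [BorelSpace X] (hθ : Continuous θ)
    {n : ℕ} (S : Stage θ n) : ∃ S' : Stage θ (n + 1), S.Ext S' := by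
  obtain ⟨a, ha, hpos⟩ := S.exists_new_row
  let i : ℕ → ℕ := Function.update S.i n a
  have hi_eq : ∀ k, k < n → i k = S.i k := fun k hk => Function.update_of_ne hk.ne _ _
  have hi_n : i n = a := Function.update_self _ _ _
  have hi : ∀ k l, k < l → l < n + 1 → i k < i l := fun k l hkl hl => by
    rcases (Nat.lt_succ_iff.1 hl).eq_or_lt with rfl | hl
    · rw [hi_n, hi_eq k hkl]; exact ha k hkl
    · rw [hi_eq k (hkl.trans hl), hi_eq l hl]; exact S.i_lt k l hkl hl
  have hI : insert a {a | ∃ k < n, a = S.i k} = {a | ∃ k < n + 1, a = i k} := by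
    ext b
    simp only [mem_insert_iff, mem_ofPred_eq]
    constructor
    · rintro (rfl | ⟨k, hk, rfl⟩)
      · exact ⟨n, by omega, hi_n.symm⟩
      · exact ⟨k, by omega, (hi_eq k hk).symm⟩
    · rintro ⟨k, hk, rfl⟩
      rcases (Nat.lt_succ_iff.1 hk).eq_or_lt with rfl | hk
      · exact Or.inl hi_n
      · exact Or.inr ⟨k, hk, hi_eq k hk⟩
  rw [hI, configs_congr fun k hk => (hi_eq k hk).symm] at hpos
  have hrow : row n < n + 1 := Nat.lt_succ_of_le (row_le n)
  have hmono : ∀ j, i (row n) ≤ j → ∀ l, l < row n → i l < j := fun j hj l hl =>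
    (hi l _ hl hrow).trans_le hj
  have hsplit := hpos.splitOn_univ hθ.measurable (κ := mask (row n) n) (i := i (row n))
    (show i (row n) ∈ {a | ∃ k < n + 1, a = i k} from ⟨row n, hrow, rfl⟩)
    (measurableSet_configs hθ.measurable fun s => (isOpen_basis (S.V s)).measurableSet)
    (fun γ hγ s s' hss j hj => hγ.2 _ (row_le n) s s' hss j (hmono j hj))
    (fun γ hγ δ hδ q h ε hεδ hεγ => configs_amalgam hγ hδ h hεδ hεγ)
  let ι := {V' : Leaf (n + 1) → TopologicalSpace.countableBasis X //
    (∀ s e, (V' (s, e) : Set X) ⊆ S.V s) ∧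
    (∀ s, ∀ x ∈ (V' s : Set X), ∀ y ∈ (V' s : Set X), dist x y < (1 / 2) ^ n) ∧
    ∀ s s', mask (row n) n s = mask (row n) n s' → ∃ c, ∀ x ∈ (V' (s, false) : Set X),
      ∀ y ∈ (V' (s', true) : Set X), θ x (i (row n)) c ≠ θ y (i (row n)) c}
  obtain ⟨⟨V', hsub, hdist, hsep⟩, hV'⟩ := hsplit.exists_of_subset_iUnion (ι := ι)
    (G' := fun V' => configs θ (n + 1) i fun s => (V'.1 s : Set X)) (by
      intro γ hγ
      have hne : ∀ s s', mask (row n) n s = mask (row n) n s' →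
          ∃ c, θ (γ (s, false)) (i (row n)) c ≠ θ (γ (s', true)) (i (row n)) c := by
        intro s s' hss
        rw [← Function.ne_iff, ← hγ.2.1.2 _ (row_le n) s s' hss _ (hmono _ le_rfl)]
        exact hγ.2.2.2.1 s (mem_univ _)
      choose! c hc using hne
      have hnhds : ∀ p : Leaf n × Bool, ∃ V : TopologicalSpace.countableBasis X,
          γ p ∈ (V : Set X) ∧ (V : Set X) ⊆ ((S.V p.1 : Set X) ∩
            Metric.ball (γ p) ((1 / 2) ^ n / 2)) ∩ {x | ∀ s s',
              θ x (i (row n)) (c s s') = θ (γ p) (i (row n)) (c s s')} := by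
        intro p
        refine exists_mem_basis (inter_mem (inter_mem ((isOpen_basis _).mem_nhds ?_)
          (Metric.ball_mem_nhds _ (by positivity))) ?_)
        · obtain ⟨s, e⟩ := p
          cases e
          exacts [hγ.1.1 s, hγ.2.1.1 s]
        · refine eventually_all.2 fun s => eventually_all.2 fun s' => ?_
          have hcont : Continuous fun x => θ x (i (row n)) (c s s') := by fun_prop
          exact hcont.continuousAt ((isOpen_discrete {θ (γ p) (i (row n)) (c s s')}).mem_nhds rfl)
      choose V' hγV' hV' using hnhds
      refine mem_iUnion.2 ⟨⟨V', fun s e x hx => (hV' _ hx).1.1, fun p x hx y hy => ?_,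
        fun s s' hss => ⟨c s s', fun x hx y hy => ?_⟩⟩, splitOn_subset_configs hγ hγV'⟩
      · have h₁ := (hV' p hx).1.2
        have h₂ := (hV' p hy).1.2
        rw [Metric.mem_ball] at h₁ h₂
        have := dist_triangle_right x y (γ p)
        linarith
      · rw [(hV' _ hx).2 s s', (hV' _ hy).2 s s']
        exact hc s s' hss)
  exact ⟨⟨i, V', hi, hV'⟩, hi_eq, hsub, hdist, hsep⟩

end Construction

/-- The `t`-th bit of an element of `(2^ℕ)^ℕ`; it belongs to the row `row t`. -/
def bit (u : ℕ → ℕ → Bool) (t : ℕ) : Bool := u t.unpair.1 t.unpair.2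

/-- The leaf of height `n` given by the first `n` bits of `u`. -/
def restr (u : ℕ → ℕ → Bool) : ∀ n, Leaf n
  | 0 => ()
  | n + 1 => (restr u n, bit u n)

lemma measurableSet_restr_eq (n : ℕ) (s : Leaf n) : MeasurableSet {u | restr u n = s} := by
  induction n with
  | zero => exact MeasurableSet.const (() = s)
  | succ n ih =>
    obtain ⟨s, e⟩ := s
    have : {u | restr u (n + 1) = (s, e)} = {u | restr u n = s} ∩ {u | bit u n = e} := by
      ext u
      exact Prod.mk_inj
    rw [this]
    have hbit : Measurable fun u => bit u n := by unfold bit; fun_prop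
    exact (ih s).inter (hbit (measurableSet_singleton e))

lemma measurable_comp_restr {X : Type*} [MeasurableSpace X] {n : ℕ} (γ : Leaf n → X) :
    Measurable fun u => γ (restr u n) := fun A _ => by
  have : (fun u => γ (restr u n)) ⁻¹' A = ⋃ s ∈ {s | γ s ∈ A}, {u | restr u n = s} := by
    ext u; simp
  rw [this]
  exact MeasurableSet.biUnion (Set.to_countable _) fun s _ => measurableSet_restr_eq n s

lemma mask_restr_eq {k n : ℕ} {u v : ℕ → ℕ → Bool}
    (h : ∀ t, t < n → k ≤ row t → bit u t = bit v t) :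
    mask k n (restr u n) = mask k n (restr v n) := by
  induction n with
  | zero => rfl
  | succ n ih =>
    exact mask_succ.2 ⟨ih fun t ht => h t (by omega), h n (by omega)⟩

section Limit

variable {X : Type*} [MetricSpace X] [SecondCountableTopology X] {θ : X → ℕ → ℕ → Bool}

lemma Stage.exists_config {n : ℕ} (S : Stage θ n) :
    ∃ γ, γ ∈ configs θ n S.i fun s => (S.V s : Set X) := by
  obtain ⟨γ, hγ, -⟩ := S.pos (fun _ _ _ _ => false) fun _ _ => measurable_const
  exact ⟨γ, hγ⟩

variable {S : ∀ n, Stage θ n} (hS : ∀ n, (S n).Ext (S (n + 1)))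
include hS

lemma stage_i_eq {k n : ℕ} (hk : k < n) : (S n).i k = (S (k + 1)).i k := by
  induction n, hk using Nat.le_induction with
  | base => rfl
  | succ n hn ih => rw [(hS n).i_eq k hn, ih]

lemma strictMono_stage_i : StrictMono fun k => (S (k + 1)).i k :=
  strictMono_nat_of_lt_succ fun k => by
    rw [← stage_i_eq hS (show k < k + 1 + 1 by omega)]
    exact (S (k + 1 + 1)).i_lt k (k + 1) (by omega) (by omega)

lemma stage_V_subset (u : ℕ → ℕ → Bool) {n m : ℕ} (h : n ≤ m) :
    ((S m).V (restr u m) : Set X) ⊆ (S n).V (restr u n) := by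
  induction m, h using Nat.le_induction with
  | base => exact Subset.rfl
  | succ m _ ih => exact ((hS m).subset _ _).trans ih

variable {γ : ∀ n, Leaf n → X}
  (hγ : ∀ n, γ n ∈ configs θ n (S n).i fun s => ((S n).V s : Set X))
include hγ

lemma exists_limit [CompleteSpace X] (u : ℕ → ℕ → Bool) :
    ∃ x, Tendsto (fun n => γ (n + 1) (restr u (n + 1))) atTop (nhds x) := by
  refine cauchySeq_tendsto_of_complete (cauchySeq_of_le_geometric (1 / 2) 1 (by norm_num) ?_)
  intro n
  rw [one_mul]
  exact ((hS n).dist_lt _ _ ((hγ _).1 _) _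
    (stage_V_subset hS u (Nat.le_succ (n + 1)) ((hγ _).1 _))).le

variable {g : (ℕ → ℕ → Bool) → X}
  (hg : ∀ u, Tendsto (fun n => γ (n + 1) (restr u (n + 1))) atTop (nhds (g u)))
include hg

lemma limit_eq (hθ : Continuous θ) {u v : ℕ → ℕ → Bool} {k : ℕ} (h : ∀ j, k ≤ j → u j = v j)
    {j : ℕ} (hj : ∀ l, l < k → (S (l + 1)).i l < j) : θ (g u) j = θ (g v) j := by
  have hc : Continuous fun x => θ x j := by fun_prop
  refine tendsto_nhds_unique_of_eventuallyEq ((hc.tendsto _).comp (hg u))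
    ((hc.tendsto _).comp (hg v)) ?_
  filter_upwards [eventually_ge_atTop k] with n hn
  refine (hγ (n + 1)).2 k (by omega) _ _ (mask_restr_eq fun t _ hkt => ?_) j fun l hl => ?_
  · exact congrFun (h _ hkt) _
  · rw [stage_i_eq hS (show l < n + 1 by omega)]
    exact hj l hl

lemma limit_ne (hθ : Continuous θ) {u v : ℕ → ℕ → Bool} {t : ℕ} (hu : bit u t = false)
    (hv : bit v t = true) (h : ∀ t', t' < t → row t ≤ row t' → bit u t' = bit v t') :
    θ (g u) ((S (row t + 1)).i (row t)) ≠ θ (g v) ((S (row t + 1)).i (row t)) := by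
  rw [← stage_i_eq hS (Nat.lt_succ_of_le (row_le t))]
  obtain ⟨c, hc⟩ := (hS t).sep _ _ (mask_restr_eq h)
  rw [← hu, ← hv] at hc
  set a := (S (t + 1)).i (row t)
  have hclosed : IsClosed {p : X × X | θ p.1 a c ≠ θ p.2 a c} := by
    have hcont : Continuous fun p : X × X => (θ p.1 a c, θ p.2 a c) := by fun_prop
    exact (isClosed_discrete {q : Bool × Bool | q.1 ≠ q.2}).preimage hcont
  have hmem := hclosed.mem_of_tendsto ((hg u).prodMk_nhds (hg v)) (by
    filter_upwards [eventually_ge_atTop t] with n hn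
    exact hc _ (stage_V_subset hS u (show t + 1 ≤ n + 1 by omega) ((hγ _).1 _)) _
      (stage_V_subset hS v (show t + 1 ≤ n + 1 by omega) ((hγ _).1 _)))
  exact fun heq => hmem (congrFun heq c)

lemma limit_reduces (hθ : Continuous θ) (u v : ℕ → ℕ → Bool) :
    E1 u v ↔ E1 (θ (g u)) (θ (g v)) := by
  rw [E1_iff, E1_iff]
  constructor
  · rintro ⟨k, hk⟩
    refine ⟨(S (k + 1)).i k, fun j hj => limit_eq hS hγ hg hθ hk fun l hl => ?_⟩
    exact (strictMono_stage_i hS hl).trans_le hj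
  · rintro ⟨k, hk⟩
    suffices h : ∀ t, k ≤ row t → bit u t = bit v t by
      refine ⟨k, fun j hj => funext fun l => ?_⟩
      have := h (Nat.pair j l) (by simpa [row] using hj)
      simpa [bit] using this
    intro t
    induction t using Nat.strong_induction_on with
    | _ t ih =>
      intro ht
      have hk' := hk _ (ht.trans (strictMono_stage_i hS).le_apply)
      have h : ∀ t', t' < t → row t ≤ row t' → bit u t' = bit v t' := fun t' ht' hr =>
        ih t' ht' (ht.trans hr)
      cases hu : bit u t <;> cases hv : bit v t
      · rfl
      · exact absurd hk' (limit_ne hS hγ hg hθ hu hv h)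
      · exact absurd hk'.symm
          (limit_ne hS hγ hg hθ hv hu fun t' ht' hr => (h t' ht' hr).symm)
      · rfl

end Limit

lemma exists_reduction_of_positive {X : Type*} [MetricSpace X] [SecondCountableTopology X]
    [CompleteSpace X] [MeasurableSpace X] [BorelSpace X] {θ : X → ℕ → ℕ → Bool}
    (hθ : Continuous θ) (hpos : Positive θ ∅ (univ : Set (Leaf 0 → X))) :
    ∃ g : (ℕ → ℕ → Bool) → X, Measurable g ∧ ∀ u v, E1 u v ↔ E1 (θ (g u)) (θ (g v)) := by
  obtain ⟨S₀⟩ := exists_stage_zero hpos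
  choose next hnext using fun n => Stage.exists_ext (n := n) hθ
  let S : ∀ n, Stage θ n := fun n => Nat.rec S₀ next n
  have hS : ∀ n, (S n).Ext (S (n + 1)) := fun n => hnext n (S n)
  choose γ hγ using fun n => (S n).exists_config
  choose g hg using exists_limit hS hγ
  refine ⟨g, ?_, limit_reduces hS hγ hg hθ⟩
  exact measurable_of_tendsto_metrizable (fun n => measurable_comp_restr (γ (n + 1)))
    (tendsto_pi_nhds.2 hg)

lemma exists_codes_of_not_positive {X : Type*} {θ : X → ℕ → ℕ → Bool}
    (hpos : ¬ Positive θ ∅ (univ : Set (Leaf 0 → X))) :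
    ∃ f : ℕ → ℕ → (ℕ → ℕ → Bool) → ℕ → Bool, (∀ i n, Measurable (f i n)) ∧
      ∀ x, ∃ J, ∀ i, J ≤ i → ∃ n, θ x i = f i n (tail (i + 1) (θ x)) := by
  simp only [Positive, not_forall, not_exists] at hpos
  obtain ⟨f, hf, h⟩ := hpos
  refine ⟨f, hf, fun x => ?_⟩
  have hx : ¬ Avoids f ∅ (θ x) := fun hx => h (fun _ => x) ⟨mem_univ _, fun _ => hx⟩
  simpa [Avoids, IsFresh] using hx

/-- The dichotomy for a continuous reduction. -/
lemma dichotomy_of_continuous {X : Type*} [TopologicalSpace X] [PolishSpace X]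
    [MeasurableSpace X] [BorelSpace X] {θ : X → ℕ → ℕ → Bool} (hθ : Continuous θ) :
    (∃ φ : X → ℕ → Bool, Measurable φ ∧ ∀ x x', E1 (θ x) (θ x') ↔ E0 (φ x) (φ x')) ∨
    ∃ g : (ℕ → ℕ → Bool) → X, Measurable g ∧ ∀ u v, E1 u v ↔ E1 (θ (g u)) (θ (g v)) := by
  let := TopologicalSpace.upgradeIsCompletelyMetrizable X
  by_cases hpos : Positive θ ∅ (univ : Set (Leaf 0 → X))
  · exact Or.inr (exists_reduction_of_positive hθ hpos)
  · obtain ⟨f, hf, h⟩ := exists_codes_of_not_positive hpos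
    obtain ⟨Φ, hΦ, hred⟩ := exists_reduction_E0 hf
    exact Or.inl ⟨fun x => Φ (θ x), hΦ.comp hθ.measurable, fun x x' => hred _ _ (h x) (h x')⟩

end ThirdDichotomy

/-- Kechris–Louveau, 3rd dichotomy: if a Borel equivalence relation `E`
on a Polish space is Borel reducible to `E₁`, then either `E ≤B E₀` or `E₁ ≤B E`. -/
theorem third_dichotomy
    {X : Type*} [TopologicalSpace X] [PolishSpace X]
    (E : X → X → Prop) (hE : Equivalence E)
    (hBorel : MeasurableSet[borel (X × X)] {p : X × X | E p.1 p.2})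
    (hred : BorelReducible E E1) :
    BorelReducible E E0 ∨ BorelReducible E1 E := by
  obtain ⟨θ, hθ, hEθ⟩ := hred
  let mX : MeasurableSpace X := borel X
  have : BorelSpace X := ⟨rfl⟩
  have hθ' : Measurable θ := by rwa [← BorelSpace.measurable_eq (α := ℕ → ℕ → Bool)] at hθ
  have hX : PolishSpace X := inferInstance
  obtain ⟨t', ht', hcont, hpol⟩ := hθ'.exists_continuous
  have hborel : @BorelSpace X t' mX := ⟨(borel_eq_borel_of_le hpol hX ht').symm⟩
  rcases @ThirdDichotomy.dichotomy_of_continuous X t' hpol mX hborel θ hcont with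
    ⟨φ, hφ, h⟩ | ⟨g, hg, h⟩
  · left
    refine ⟨φ, ?_, fun x x' => (hEθ x x').trans (h x x')⟩
    rwa [← BorelSpace.measurable_eq (α := ℕ → Bool)]
  · right
    refine ⟨g, ?_, fun u v => (h u v).trans (hEθ _ _).symm⟩
    rwa [← BorelSpace.measurable_eq (α := ℕ → ℕ → Bool)]
end
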